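/- There exists a constant C > 0 such that for every r ∈ (0, 1/8) and every function h that is continuous on the closed annulus {x ∈ ℝ⁴ : r ≤ |x| ≤ 1} and harmonic on the open annulus A(r,1) = {x ∈ ℝ⁴ : r < |x| < 1}, there exist real constants a and b with the following properties: the function g(x) := h(x) + a + b·|x|^{−2} satisfies ∫_{|x|=1} g dσ = 0 and ∫_{|x|=r} g dσ = 0, and moreover Λ_{A(2r,1/2)}(g) ≤ C · ‖h‖_{L²(A(r,1))}. The constant C is independent of r and of h. -/

import Mathlib

open MeasureTheory Filter Set ENNReal

noncomputable section

/-- A function is harmonic on an open set `U ⊆ ℝⁿ` if it is twice continuously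
differentiable there and its Laplacian (the sum of second partial derivatives)
vanishes on `U`. -/
def IsHarmonicOn {n : ℕ} (u : EuclideanSpace ℝ (Fin n) → ℝ)
    (U : Set (EuclideanSpace ℝ (Fin n))) : Prop :=
  ContDiffOn ℝ 2 u U ∧
    ∀ x ∈ U,
      (∑ i : Fin n,
        fderiv ℝ (fun y => fderiv ℝ u y (EuclideanSpace.single i (1 : ℝ))) x
          (EuclideanSpace.single i (1 : ℝ))) = 0

/-- `Λ_Ω(g) = ∫₀^∞ (L {x ∈ Ω : |g x| > λ})^{1/2} dλ`, a quantity comparable to the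
Lorentz norm `‖g‖_{L^{2,1}(Ω)}`. -/
def Lam {n : ℕ} (Ω : Set (EuclideanSpace ℝ (Fin n)))
    (g : EuclideanSpace ℝ (Fin n) → ℝ) : ℝ≥0∞ :=
  ∫⁻ l in Set.Ioi (0 : ℝ), (volume {x | x ∈ Ω ∧ l < |g x|}) ^ ((1 : ℝ) / 2)


abbrev E4 := EuclideanSpace ℝ (Fin 4)

lemma hausdorff_sphere_lt_top (ρ : ℝ) (hρ : 0 < ρ) :
    (μH[(3 : ℝ)] : Measure E4) (Metric.sphere (0 : E4) ρ) < ⊤ := by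
  let Φ : Fin 4 × Bool → (Fin 3 → ℝ) → E4 := fun p y =>
    WithLp.toLp 2 (Fin.insertNth p.1 (if p.2 then (1:ℝ) else -1) y)
  let Ψ : Fin 4 × Bool → (Fin 3 → ℝ) → E4 := fun p y => (ρ * ‖Φ p y‖⁻¹) • Φ p y
  have hΦi : ∀ p y, (Φ p y) p.1 = if p.2 then (1:ℝ) else -1 := by
    intro p y; simp [Φ]
  have hΦ0 : ∀ p y, Φ p y ≠ 0 := by
    intro p y h0
    have := hΦi p y
    rw [h0] at this
    rcases p with ⟨i, b⟩
    cases b <;> norm_num at this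
  have hΦc : ∀ p, ContDiff ℝ 1 (Φ p) := by
    intro p
    rw [contDiff_euclidean]
    intro j
    rcases Fin.eq_self_or_eq_succAbove p.1 j with h | ⟨k, h⟩
    · subst h
      simp only [Φ, Fin.insertNth_apply_same]
      exact contDiff_const
    · subst h
      simp only [Φ, Fin.insertNth_apply_succAbove]
      fun_prop
  have hΨc : ∀ p, ContDiff ℝ 1 (Ψ p) := by
    intro p
    have : ContDiff ℝ 1 (fun y => ‖Φ p y‖) := (hΦc p).norm ℝ (hΦ0 p)
    exact (contDiff_const.mul (this.inv (fun y => norm_ne_zero_iff.2 (hΦ0 p y)))).smul (hΦc p)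
  let Q : Set (Fin 3 → ℝ) := Set.Icc (-1) 1
  have hQ : IsCompact Q := isCompact_Icc
  have hfin : ∀ p, (μH[(3 : ℝ)] : Measure E4) (Ψ p '' Q) < ⊤ := by
    intro p
    obtain ⟨K, hK⟩ := ((hΨc p).locallyLipschitz).locallyLipschitzOn.exists_lipschitzOnWith_of_compact hQ
    refine (hK.hausdorffMeasure_image_le (by norm_num : (0:ℝ) ≤ 3)).trans_lt ?_
    have : (μH[(3 : ℝ)] : Measure (Fin 3 → ℝ)) = volume := by
      have := hausdorffMeasure_pi_real (ι := Fin 3)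
      simpa using this
    rw [this]
    exact ENNReal.mul_lt_top (by simp) hQ.measure_lt_top
  have hcov : Metric.sphere (0 : E4) ρ ⊆ ⋃ p, Ψ p '' Q := by
    intro x hx
    have hxn : ‖x‖ = ρ := by simpa using hx
    obtain ⟨i, -, hi⟩ := Finset.exists_max_image Finset.univ (fun i => |x i|) ⟨0, Finset.mem_univ _⟩
    have hxi : x i ≠ 0 := by
      intro h0
      have : x = 0 := by
        ext j
        have := hi j (Finset.mem_univ _)
        rw [h0] at this
        simpa using this
      rw [this] at hxn; simp at hxn; linarith
    have hxa : 0 < |x i| := abs_pos.2 hxi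
    refine Set.mem_iUnion.2 ⟨(i, decide (0 < x i)), fun k => x (i.succAbove k) / |x i|, ?_, ?_⟩
    · constructor <;> intro k
      · have := hi (i.succAbove k) (Finset.mem_univ _)
        have h2 := neg_abs_le (x (i.succAbove k))
        simp only [Pi.neg_apply, Pi.one_apply]
        rw [le_div_iff₀ hxa]; linarith
      · have := hi (i.succAbove k) (Finset.mem_univ _)
        have h2 := le_abs_self (x (i.succAbove k))
        simp only [Pi.one_apply]
        rw [div_le_iff₀ hxa]; linarith
    · have hw : Φ (i, decide (0 < x i)) (fun k => x (i.succAbove k) / |x i|) = |x i|⁻¹ • x := by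
        ext j
        rcases Fin.eq_self_or_eq_succAbove i j with h | ⟨k, h⟩
        · subst h
          rcases lt_or_gt_of_ne hxi with h | h
          · simp [Φ, not_lt.2 h.le, abs_of_neg h]; field_simp
          · simp [Φ, h, abs_of_pos h]; field_simp
        · subst h
          simp [Φ, div_eq_inv_mul]
      simp only [Ψ, hw, norm_smul, norm_inv, Real.norm_eq_abs, abs_abs, smul_smul, hxn]
      have : ρ * (|x i|⁻¹ * ρ)⁻¹ * |x i|⁻¹ = 1 := by field_simp
      rw [this, one_smul]
  refine (measure_mono hcov).trans_lt ?_
  refine (measure_iUnion_le _).trans_lt ?_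
  rw [tsum_fintype]
  exact ENNReal.sum_lt_top.2 (fun p _ => hfin p)


abbrev GQ := Metric.sphere (0 : Quaternion ℝ) 1

instance instMSGQ : MeasurableSpace GQ := borel GQ
instance instBSGQ : BorelSpace GQ := ⟨rfl⟩

instance instPSQ : ProperSpace (Quaternion ℝ) := by
  have : FiniteDimensional ℝ (Quaternion ℝ) :=
    Quaternion.linearIsometryEquivTuple.toLinearEquiv.symm.finiteDimensional
  exact FiniteDimensional.proper ℝ _

def muG : Measure GQ := (Measure.haarMeasure (⊤ : TopologicalSpace.PositiveCompacts GQ)).inv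

instance instRI : muG.IsMulRightInvariant := by unfold muG; infer_instance

instance instPr : IsProbabilityMeasure muG := by
  constructor
  unfold muG
  rw [Measure.inv_apply]
  have := Measure.haarMeasure_self (K₀ := (⊤ : TopologicalSpace.PositiveCompacts GQ))
  simpa only [TopologicalSpace.PositiveCompacts.coe_top, inv_univ] using this

def actQ (p : GQ) : Quaternion ℝ ≃ₗᵢ[ℝ] Quaternion ℝ where
  toFun x := (p : Quaternion ℝ) * x
  invFun x := (p : Quaternion ℝ)⁻¹ * x
  map_add' := by intro x y; simp [mul_add]
  map_smul' := by intro c x; simp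
  left_inv := by
    intro x
    have : (p : Quaternion ℝ) ≠ 0 := ne_zero_of_mem_unit_sphere p
    simp [this]
  right_inv := by
    intro x
    have : (p : Quaternion ℝ) ≠ 0 := ne_zero_of_mem_unit_sphere p
    simp [this]
  norm_map' := by
    intro x
    have : ‖(p : Quaternion ℝ)‖ = 1 := by simpa using p.2
    simp [this]

def act (p : GQ) : E4 ≃ₗᵢ[ℝ] E4 :=
  (Quaternion.linearIsometryEquivTuple.symm.trans (actQ p)).trans Quaternion.linearIsometryEquivTuple

lemma act_apply (p : GQ) (x : E4) : act p x =
    Quaternion.linearIsometryEquivTuple ((p : Quaternion ℝ) * Quaternion.linearIsometryEquivTuple.symm x) := rfl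

lemma act_mul (p q : GQ) (x : E4) : act (p * q) x = act p (act q x) := by
  rw [act_apply, act_apply, act_apply, LinearIsometryEquiv.symm_apply_apply, ← mul_assoc]
  rfl

lemma continuous_act : Continuous (fun z : GQ × E4 => act z.1 z.2) := by
  simp only [act_apply]
  refine Quaternion.linearIsometryEquivTuple.continuous.comp ?_
  exact (continuous_subtype_val.comp continuous_fst).mul
    (Quaternion.linearIsometryEquivTuple.symm.continuous.comp continuous_snd)

lemma norm_act (p : GQ) (x : E4) : ‖act p x‖ = ‖x‖ := (act p).norm_map x

def avg (h : E4 → ℝ) (w : E4) : ℝ := ∫ p, h (act p w) ∂muG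

lemma avg_radial (h : E4 → ℝ) (w w' : E4) (hw : ‖w‖ = ‖w'‖) : avg h w = avg h w' := by
  by_cases h0 : w = 0
  · subst h0
    have : w' = 0 := by rw [← norm_eq_zero, ← hw]; simp
    rw [this]
  let e := Quaternion.linearIsometryEquivTuple
  have hq : ‖(e.symm w') * (e.symm w)⁻¹‖ = 1 := by
    rw [norm_mul, norm_inv, e.symm.norm_map, e.symm.norm_map, hw, mul_inv_cancel₀]
    rw [← hw]; exact norm_ne_zero_iff.2 h0
  let q : GQ := ⟨(e.symm w') * (e.symm w)⁻¹, by simpa using hq⟩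
  have hqw : act q w = w' := by
    rw [act_apply]
    have : e.symm w ≠ 0 := by simpa using h0
    change e ((e.symm w' * (e.symm w)⁻¹) * e.symm w) = w'
    rw [mul_assoc, inv_mul_cancel₀ this]; simp
  unfold avg
  rw [← hqw, ← integral_mul_right_eq_self (μ := muG) (fun p => h (act p w)) q]
  simp only [act_mul]

lemma integral_sphere_zero (g : E4 → ℝ) (ρ : ℝ) (hρ : 0 < ρ)
    (hg : ContinuousOn g (Metric.sphere (0 : E4) ρ))
    (h0 : ∀ x ∈ Metric.sphere (0 : E4) ρ, avg g x = 0) :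
    ∫ x in Metric.sphere (0 : E4) ρ, g x ∂(μH[(3 : ℝ)]) = 0 := by
  let S := Metric.sphere (0 : E4) ρ
  let ν : Measure E4 := (μH[(3:ℝ)] : Measure E4).restrict S
  have hSm : MeasurableSet S := Metric.isClosed_sphere.measurableSet
  have hfin : IsFiniteMeasure ν := ⟨by
    simpa [ν, S] using hausdorff_sphere_lt_top ρ hρ⟩
  have hinv : ∀ p : GQ, ∫ x in S, g (act p x) ∂(μH[(3 : ℝ)]) = ∫ x in S, g x ∂(μH[(3 : ℝ)]) := by
    intro p
    have hmp := (act p).toIsometryEquiv.measurePreserving_hausdorffMeasure (3:ℝ)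
    have := hmp.setIntegral_preimage_emb (act p).toHomeomorph.measurableEmbedding g S
    rw [← this]
    congr 2
    ext x
    simp [S]
  obtain ⟨M, hM⟩ := (isCompact_sphere (0:E4) ρ).exists_bound_of_continuousOn hg
  have hcont : ContinuousOn (fun z : GQ × E4 => g (act z.1 z.2)) (univ ×ˢ S) := by
    refine hg.comp continuous_act.continuousOn ?_
    rintro ⟨p, x⟩ ⟨-, hx⟩
    simpa [S, norm_act] using hx
  -- integrability
  let g' : E4 → ℝ := S.indicator g
  have hg'm : Measurable g' := by
    refine measurable_of_restrict_of_restrict_compl hSm ?_ ?_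
    · have : S.domRestrict g' = S.domRestrict g := by
        ext x; simp [g']
      rw [this]; exact hg.domRestrict.measurable
    · have : Sᶜ.domRestrict g' = fun _ => 0 := by
        ext x
        have : (x:E4) ∉ S := x.2
        simp [g', this]
      rw [this]; exact measurable_const
  have hg'b : ∀ x, ‖g' x‖ ≤ max M 0 := by
    intro x
    by_cases hx : x ∈ S
    · simp only [g', indicator_of_mem hx]; exact (hM x hx).trans (le_max_left _ _)
    · simp [g', indicator_of_notMem hx]
  have hgg : ∀ p : GQ, ∀ x ∈ S, g (act p x) = g' (act p x) := by
    intro p x hx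
    have : act p x ∈ S := by simpa [S, norm_act] using hx
    simp [g', this]
  have hsc : SecondCountableTopology GQ := inferInstance
  have hint : Integrable (fun z : GQ × E4 => g' (act z.1 z.2)) (muG.prod ν) := by
    refine Integrable.of_bound (C := max M 0) ?_ (Eventually.of_forall fun z => hg'b _)
    exact (hg'm.comp continuous_act.measurable).aestronglyMeasurable
  have key := integral_integral_swap (μ := muG) (ν := ν) (f := fun p x => g' (act p x)) hint
  have h1 : ∀ p : GQ, ∫ x, g' (act p x) ∂ν = ∫ x in S, g x ∂(μH[(3 : ℝ)]) := by
    intro p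
    rw [← hinv p]
    exact setIntegral_congr_fun hSm (fun x hx => (hgg p x hx).symm)
  have h2 : ∫ x, ∫ p, g' (act p x) ∂muG ∂ν = 0 := by
    have : ∫ x in S, (∫ p, g' (act p x) ∂muG) ∂(μH[(3 : ℝ)]) = ∫ x in S, (0:ℝ) ∂(μH[(3 : ℝ)]) := by
      refine setIntegral_congr_fun hSm (fun x hx => ?_)
      have := h0 x hx
      unfold avg at this
      simp only [← hgg _ x hx]
      exact this
    simpa using this
  rw [h2] at key
  simp only [h1] at key
  simpa using key

lemma cont_act {X : Type*} [TopologicalSpace X] {f : X → GQ} {g : X → E4} (hf : Continuous f)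
    (hg : Continuous g) : Continuous (fun x => act (f x) (g x)) := by
  simp only [act_apply]
  refine Quaternion.linearIsometryEquivTuple.continuous.comp ?_
  exact (continuous_subtype_val.comp hf).mul
    (Quaternion.linearIsometryEquivTuple.symm.continuous.comp hg)

attribute [irreducible] act muG avg

lemma avg_def (h : E4 → ℝ) (w : E4) : avg h w = ∫ p, h (act p w) ∂muG := by
  unfold avg; rfl


lemma hasDerivAt_integral_GQ (F F' : ℝ → GQ → ℝ) (I : Set ℝ) (hI : IsOpen I)
    (hF : ∀ t ∈ I, Continuous (F t))
    (hF' : ContinuousOn (fun z : ℝ × GQ => F' z.1 z.2) (I ×ˢ univ))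
    (hd : ∀ t ∈ I, ∀ p, HasDerivAt (fun s => F s p) (F' t p) t) (t : ℝ) (ht : t ∈ I) :
    HasDerivAt (fun s => ∫ p, F s p ∂muG) (∫ p, F' t p ∂muG) t := by
  obtain ⟨δ, hδ, hball⟩ := Metric.nhds_basis_closedBall.mem_iff.1 (hI.mem_nhds ht)
  have hcomp : IsCompact (Metric.closedBall t δ ×ˢ (univ : Set GQ)) :=
    (isCompact_closedBall t δ).prod isCompact_univ
  obtain ⟨M, hM⟩ := hcomp.exists_bound_of_continuousOn (hF'.mono (prod_mono hball subset_rfl))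
  have hcF' : Continuous (F' t) := by
    rw [← continuousOn_univ]
    exact hF'.comp (f := fun p : GQ => (t, p)) (by fun_prop) (fun p _ => ⟨ht, trivial⟩)
  refine (hasDerivAt_integral_of_dominated_loc_of_deriv_le (μ := muG) (F := F) (F' := F')
    (bound := fun _ => M) (s := Metric.closedBall t δ) (Metric.closedBall_mem_nhds t hδ) ?_ ?_ ?_ ?_ ?_ ?_).2
  · filter_upwards [hI.mem_nhds ht] with s hs
    exact (hF s hs).aestronglyMeasurable
  · exact (hF t ht).integrable_of_hasCompactSupport (HasCompactSupport.of_compactSpace _)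
  · exact hcF'.aestronglyMeasurable
  · exact Eventually.of_forall fun p s hs => hM (s, p) ⟨hs, trivial⟩
  · exact integrable_const _
  · exact Eventually.of_forall fun p s hs => hd s (hball hs) p

/-- the open annulus -/
def Ann (r : ℝ) : Set E4 := {x | r < ‖x‖ ∧ ‖x‖ < 1}

lemma isOpen_Ann (r : ℝ) : IsOpen (Ann r) :=
  (isOpen_lt continuous_const continuous_norm).inter (isOpen_lt continuous_norm continuous_const)

lemma continuous_act_comp (w : ℝ → E4) (hw : Continuous w) :
    Continuous (fun z : ℝ × GQ => act z.2 (w z.1)) := by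
  exact cont_act continuous_snd (hw.comp continuous_fst)

lemma avg_deriv1 (r : ℝ) (h : E4 → ℝ) (hh : ContDiffOn ℝ 2 h (Ann r)) (w w' : ℝ → E4)
    (I : Set ℝ) (hI : IsOpen I) (hw : ∀ t ∈ I, w t ∈ Ann r)
    (hw1 : ∀ t, HasDerivAt w (w' t) t) (hw2 : Continuous w') (t : ℝ) (ht : t ∈ I) :
    HasDerivAt (fun s => avg h (w s)) (∫ p, fderiv ℝ h (act p (w t)) (act p (w' t)) ∂muG) t := by
  have hU := isOpen_Ann r
  have hwc : Continuous w := continuous_iff_continuousAt.2 fun s => (hw1 s).continuousAt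
  have hact : ∀ s ∈ I, ∀ p, act p (w s) ∈ Ann r := by
    intro s hs p
    simpa [Ann, norm_act] using hw s hs
  simp only [avg_def]
  refine hasDerivAt_integral_GQ (fun s p => h (act p (w s)))
    (fun s p => fderiv ℝ h (act p (w s)) (act p (w' s))) I hI ?_ ?_ ?_ t ht
  · intro s hs
    rw [← continuousOn_univ]
    refine hh.continuousOn.comp (f := fun p : GQ => act p (w s)) ?_ (fun p _ => hact s hs p)
    exact (cont_act continuous_id continuous_const).continuousOn
  · have h1 : ContinuousOn (fderiv ℝ h) (Ann r) := hh.continuousOn_fderiv_of_isOpen hU (by norm_num)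
    have h2 : ContinuousOn (fun z : ℝ × GQ => fderiv ℝ h (act z.2 (w z.1))) (I ×ˢ univ) := by
      refine h1.comp (f := fun z : ℝ × GQ => act z.2 (w z.1)) ?_ (fun z hz => hact z.1 hz.1 z.2)
      exact (continuous_act_comp _ hwc).continuousOn
    refine h2.clm_apply ?_
    exact (continuous_act_comp _ hw2).continuousOn
  · intro s hs p
    have hd : DifferentiableAt ℝ h (act p (w s)) :=
      ((hh.contDiffAt (hU.mem_nhds (hact s hs p))).differentiableAt (by norm_num))
    have hl : HasDerivAt (fun u => act p (w u)) (act p (w' s)) s :=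
      ((act p).toContinuousLinearEquiv.toContinuousLinearMap.hasFDerivAt).comp_hasDerivAt s (hw1 s)
    exact hd.hasFDerivAt.comp_hasDerivAt s hl

lemma avg_deriv2 (r : ℝ) (h : E4 → ℝ) (hh : ContDiffOn ℝ 2 h (Ann r)) (w w' w'' : ℝ → E4)
    (I : Set ℝ) (hI : IsOpen I) (hw : ∀ t ∈ I, w t ∈ Ann r)
    (hw1 : ∀ t, HasDerivAt w (w' t) t) (hw2 : ∀ t, HasDerivAt w' (w'' t) t)
    (hw3 : Continuous w'') (t : ℝ) (ht : t ∈ I) :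
    HasDerivAt (fun s => ∫ p, fderiv ℝ h (act p (w s)) (act p (w' s)) ∂muG)
      (∫ p, (fderiv ℝ (fderiv ℝ h) (act p (w t)) (act p (w' t)) (act p (w' t)) +
        fderiv ℝ h (act p (w t)) (act p (w'' t))) ∂muG) t := by
  have hU := isOpen_Ann r
  have hwc : Continuous w := continuous_iff_continuousAt.2 fun s => (hw1 s).continuousAt
  have hwc' : Continuous w' := continuous_iff_continuousAt.2 fun s => (hw2 s).continuousAt
  have hact : ∀ s ∈ I, ∀ p, act p (w s) ∈ Ann r := by
    intro s hs p
    simpa [Ann, norm_act] using hw s hs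
  have hD : ContDiffOn ℝ 1 (fderiv ℝ h) (Ann r) :=
    hh.fderiv_of_isOpen hU (by norm_num : (1:WithTop ℕ∞) + 1 ≤ 2)
  have hD2 : ContinuousOn (fderiv ℝ (fderiv ℝ h)) (Ann r) :=
    hD.continuousOn_fderiv_of_isOpen hU le_rfl
  have c0 : Continuous (fun z : ℝ × GQ => act z.2 (w z.1)) :=
    continuous_act_comp _ hwc
  have c1 : Continuous (fun z : ℝ × GQ => act z.2 (w' z.1)) :=
    continuous_act_comp _ hwc'
  have c2 : Continuous (fun z : ℝ × GQ => act z.2 (w'' z.1)) :=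
    continuous_act_comp _ hw3
  have h1 : ContinuousOn (fun z : ℝ × GQ => fderiv ℝ h (act z.2 (w z.1))) (I ×ˢ univ) :=
    hD.continuousOn.comp (f := fun z : ℝ × GQ => act z.2 (w z.1)) c0.continuousOn
      (fun z hz => hact z.1 hz.1 z.2)
  have h2 : ContinuousOn (fun z : ℝ × GQ => fderiv ℝ (fderiv ℝ h) (act z.2 (w z.1))) (I ×ˢ univ) :=
    hD2.comp
      (f := fun z : ℝ × GQ => act z.2 (w z.1)) c0.continuousOn (fun z hz => hact z.1 hz.1 z.2)
  refine hasDerivAt_integral_GQ (fun s p => fderiv ℝ h (act p (w s)) (act p (w' s)))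
    (fun s p => fderiv ℝ (fderiv ℝ h) (act p (w s)) (act p (w' s)) (act p (w' s)) +
        fderiv ℝ h (act p (w s)) (act p (w'' s))) I hI ?_ ?_ ?_ t ht
  · intro s hs
    rw [← continuousOn_univ]
    have h3 : ContinuousOn (fun z : ℝ × GQ => fderiv ℝ h (act z.2 (w z.1)) (act z.2 (w' z.1)))
      (I ×ˢ univ) := h1.clm_apply c1.continuousOn
    have h4 : ContinuousOn (fun p : GQ => (s, p)) univ := by fun_prop
    exact h3.comp h4 (fun p _ => ⟨hs, trivial⟩)
  · have h5 : ContinuousOn (fun z : ℝ × GQ => fderiv ℝ (fderiv ℝ h) (act z.2 (w z.1))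
      (act z.2 (w' z.1))) (I ×ˢ univ) := h2.clm_apply c1.continuousOn
    exact (h5.clm_apply c1.continuousOn).add (h1.clm_apply c2.continuousOn)
  · intro s hs p
    have hd : DifferentiableAt ℝ (fderiv ℝ h) (act p (w s)) :=
      ((hD.contDiffAt (hU.mem_nhds (hact s hs p))).differentiableAt (by norm_num))
    have hl : HasDerivAt (fun u => act p (w u)) (act p (w' s)) s :=
      ((act p).toContinuousLinearEquiv.toContinuousLinearMap.hasFDerivAt).comp_hasDerivAt s (hw1 s)
    have hl' : HasDerivAt (fun u => act p (w' u)) (act p (w'' s)) s :=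
      ((act p).toContinuousLinearEquiv.toContinuousLinearMap.hasFDerivAt).comp_hasDerivAt s (hw2 s)
    have hc : HasDerivAt (fun u => fderiv ℝ h (act p (w u)))
        (fderiv ℝ (fderiv ℝ h) (act p (w s)) (act p (w' s))) s :=
      hd.hasFDerivAt.comp_hasDerivAt s hl
    exact hc.clm_apply hl'

lemma trace_act (r : ℝ) (h : E4 → ℝ) (hh : IsHarmonicOn h (Ann r)) (x : E4) (hx : x ∈ Ann r)
    (p : GQ) :
    ∑ i : Fin 4, fderiv ℝ (fderiv ℝ h) x (act p (EuclideanSpace.single i (1:ℝ)))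
      (act p (EuclideanSpace.single i (1:ℝ))) = 0 := by
  have hU := isOpen_Ann r
  have hD : DifferentiableAt ℝ (fderiv ℝ h) x :=
    ((hh.1.fderiv_of_isOpen hU (by norm_num : (1:WithTop ℕ∞) + 1 ≤ 2)).contDiffAt
      (hU.mem_nhds hx)).differentiableAt (by norm_num)
  have h1 := hh.2 x hx
  have h2 : ∀ i : Fin 4, fderiv ℝ (fun y => fderiv ℝ h y (EuclideanSpace.single i (1 : ℝ))) x
          (EuclideanSpace.single i (1 : ℝ)) = fderiv ℝ (fderiv ℝ h) x
          (EuclideanSpace.single i (1 : ℝ)) (EuclideanSpace.single i (1 : ℝ)) := by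
    intro i
    rw [fderiv_clm_apply hD (differentiableAt_const _)]
    simp
  simp only [h2] at h1
  let b := EuclideanSpace.basisFun (Fin 4) ℝ
  have e1 := congrFun (InnerProductSpace.laplacian_eq_iteratedFDeriv_orthonormalBasis h b) x
  have e2 := congrFun (InnerProductSpace.laplacian_eq_iteratedFDeriv_orthonormalBasis h (b.map (act p))) x
  rw [e1] at e2
  simp only [iteratedFDeriv_two_apply, b] at e2
  simp at e2
  rw [← e2]
  exact h1


lemma cont_D2 (r : ℝ) (h : E4 → ℝ) (hh : ContDiffOn ℝ 2 h (Ann r)) (x v : E4) (hx : x ∈ Ann r) :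
    Continuous (fun p : GQ => fderiv ℝ (fderiv ℝ h) (act p x) (act p v) (act p v)) := by
  have hU := isOpen_Ann r
  have hD : ContDiffOn ℝ 1 (fderiv ℝ h) (Ann r) :=
    hh.fderiv_of_isOpen hU (by norm_num : (1:WithTop ℕ∞) + 1 ≤ 2)
  have hD2 : ContinuousOn (fderiv ℝ (fderiv ℝ h)) (Ann r) :=
    hD.continuousOn_fderiv_of_isOpen hU le_rfl
  have c0 : Continuous (fun p : GQ => act p x) := cont_act continuous_id continuous_const
  have c1 : Continuous (fun p : GQ => act p v) := cont_act continuous_id continuous_const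
  have h2 : Continuous (fun p : GQ => fderiv ℝ (fderiv ℝ h) (act p x)) := by
    rw [← continuousOn_univ]
    exact hD2.comp c0.continuousOn (fun p _ => by simpa [Ann, norm_act] using hx)
  have h3 : Continuous (fun p : GQ => fderiv ℝ (fderiv ℝ h) (act p x) (act p v)) := h2.clm_apply c1
  exact h3.clm_apply c1

lemma cont_D1 (r : ℝ) (h : E4 → ℝ) (hh : ContDiffOn ℝ 2 h (Ann r)) (x v : E4) (hx : x ∈ Ann r) :
    Continuous (fun p : GQ => fderiv ℝ h (act p x) (act p v)) := by
  have hU := isOpen_Ann r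
  have hD : ContDiffOn ℝ 1 (fderiv ℝ h) (Ann r) :=
    hh.fderiv_of_isOpen hU (by norm_num : (1:WithTop ℕ∞) + 1 ≤ 2)
  have c0 : Continuous (fun p : GQ => act p x) := cont_act continuous_id continuous_const
  have c1 : Continuous (fun p : GQ => act p v) := cont_act continuous_id continuous_const
  have h2 : Continuous (fun p : GQ => (fderiv ℝ h) (act p x)) := by
    rw [← continuousOn_univ]
    exact hD.continuousOn.comp c0.continuousOn (fun p _ => by simpa [Ann, norm_act] using hx)
  exact h2.clm_apply c1

lemma intGQ {f : GQ → ℝ} (hf : Continuous f) : Integrable f muG :=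
  hf.integrable_of_hasCompactSupport (HasCompactSupport.of_compactSpace _)

abbrev ee (i : Fin 4) : E4 := EuclideanSpace.single i (1:ℝ)

lemma norm_circle (ρ t : ℝ) (hρ : 0 < ρ) (i : Fin 4) (hi : i ≠ 0) :
    ‖Real.cos t • (ρ • ee 0) + Real.sin t • (ρ • ee i)‖ = ρ := by
  have : ‖Real.cos t • (ρ • ee 0) + Real.sin t • (ρ • ee i)‖ ^ 2 = ρ ^ 2 := by
    rw [EuclideanSpace.norm_sq_eq]
    fin_cases i
    · exact absurd rfl hi
    all_goals
      simp [ee, Fin.sum_univ_four]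
      nlinarith [Real.sin_sq_add_cos_sq t]
  nlinarith [norm_nonneg (Real.cos t • (ρ • ee 0) + Real.sin t • (ρ • ee i)), this,
    sq_nonneg (‖Real.cos t • (ρ • ee 0) + Real.sin t • (ρ • ee i)‖ - ρ)]

lemma circle_identity (r : ℝ) (h : E4 → ℝ) (hh : ContDiffOn ℝ 2 h (Ann r)) (ρ : ℝ) (hr : 0 < r)
    (hρ : r < ρ) (hρ1 : ρ < 1) (i : Fin 4) (hi : i ≠ 0) :
    ρ * ∫ p, fderiv ℝ (fderiv ℝ h) (act p (ρ • ee 0)) (act p (ee i)) (act p (ee i)) ∂muG =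
      ∫ p, fderiv ℝ h (act p (ρ • ee 0)) (act p (ee 0)) ∂muG := by
  have hρ0 : 0 < ρ := hr.trans hρ
  let w : ℝ → E4 := fun t => Real.cos t • (ρ • ee 0) + Real.sin t • (ρ • ee i)
  let w' : ℝ → E4 := fun t => (-Real.sin t) • (ρ • ee 0) + Real.cos t • (ρ • ee i)
  let w'' : ℝ → E4 := fun t => (-Real.cos t) • (ρ • ee 0) + (-Real.sin t) • (ρ • ee i)
  have d1 : ∀ t, HasDerivAt w (w' t) t := fun t =>
    ((Real.hasDerivAt_cos t).smul_const _).add ((Real.hasDerivAt_sin t).smul_const _)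
  have d2 : ∀ t, HasDerivAt w' (w'' t) t := fun t =>
    ((Real.hasDerivAt_sin t).neg.smul_const _).add ((Real.hasDerivAt_cos t).smul_const _)
  have c2 : Continuous w'' := by fun_prop
  have c1 : Continuous w' := by fun_prop
  have hw : ∀ t ∈ (univ : Set ℝ), w t ∈ Ann r := by
    intro t _
    simp only [Ann, mem_setOf_eq, w, norm_circle ρ t hρ0 i hi]
    exact ⟨hρ, hρ1⟩
  have hconst : (fun s => avg h (w s)) = fun _ => avg h (w 0) := by
    funext s
    refine avg_radial h _ _ ?_
    simp only [w]
    rw [norm_circle ρ s hρ0 i hi, norm_circle ρ 0 hρ0 i hi]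
  have hz : (fun s => ∫ p, fderiv ℝ h (act p (w s)) (act p (w' s)) ∂muG) = fun _ => 0 := by
    funext s
    have e1 := avg_deriv1 r h hh w w' univ isOpen_univ hw d1 c1 s trivial
    rw [hconst] at e1
    exact e1.unique (hasDerivAt_const s _)
  have e2 := avg_deriv2 r h hh w w' w'' univ isOpen_univ hw d1 d2 c2 0 trivial
  rw [hz] at e2
  have e3 := e2.unique (hasDerivAt_const (0:ℝ) (0:ℝ))
  have w0 : w 0 = ρ • ee 0 := by simp [w]
  have w0' : w' 0 = ρ • ee i := by simp [w']
  have w0'' : w'' 0 = (-ρ) • ee 0 := by simp [w'']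
  rw [w0, w0', w0''] at e3
  simp only [map_smul, ContinuousLinearMap.smul_apply, smul_eq_mul] at e3
  have hx : ρ • ee 0 ∈ Ann r := by
    rw [← w0]; exact hw 0 trivial
  have i1 := intGQ (cont_D2 r h hh (ρ • ee 0) (ee i) hx)
  have i2 := intGQ (cont_D1 r h hh (ρ • ee 0) (ee 0) hx)
  simp only [map_smul] at i1 i2 ⊢
  rw [integral_add ((i1.const_mul ρ).const_mul ρ) (i2.const_mul (-ρ)), integral_const_mul,
    integral_const_mul, integral_const_mul] at e3
  have : ρ * (ρ * (∫ p, fderiv ℝ (fderiv ℝ h) (ρ • act p (ee 0)) (act p (ee i)) (act p (ee i)) ∂muG) -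
    ∫ p, fderiv ℝ h (ρ • act p (ee 0)) (act p (ee 0)) ∂muG) = 0 := by linarith
  rcases mul_eq_zero.1 this with h | h
  · linarith
  · linarith

lemma avg_form (r : ℝ) (hr : 0 < r) (hr1 : r < 1) (h : E4 → ℝ)
    (hc : ContinuousOn h {x | r ≤ ‖x‖ ∧ ‖x‖ ≤ 1}) (hh : IsHarmonicOn h (Ann r)) :
    ∃ A B : ℝ, ∀ x : E4, r ≤ ‖x‖ → ‖x‖ ≤ 1 → avg h x = A + B * (‖x‖ ^ 2)⁻¹ := by
  let H : ℝ → ℝ := fun ρ => avg h (ρ • ee 0)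
  let H1 : ℝ → ℝ := fun ρ => ∫ p, fderiv ℝ h (act p (ρ • ee 0)) (act p (ee 0)) ∂muG
  let H2 : ℝ → ℝ := fun ρ => ∫ p, fderiv ℝ (fderiv ℝ h) (act p (ρ • ee 0)) (act p (ee 0)) (act p (ee 0)) ∂muG
  have hn : ∀ ρ : ℝ, 0 < ρ → ‖ρ • ee 0‖ = ρ := by
    intro ρ hρ
    simp [norm_smul, abs_of_pos hρ]
  have hw : ∀ t ∈ Ioo r 1, t • ee 0 ∈ Ann r := by
    intro t ht
    simp only [Ann, mem_setOf_eq, hn t (hr.trans ht.1)]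
    exact ht
  have d1 : ∀ t : ℝ, HasDerivAt (fun s : ℝ => s • ee 0) (ee 0) t := by
    intro t
    simpa using (hasDerivAt_id t).smul_const (ee 0)
  have dH : ∀ t ∈ Ioo r 1, HasDerivAt H (H1 t) t := fun t ht =>
    avg_deriv1 r h hh.1 (fun s => s • ee 0) (fun _ => ee 0) (Ioo r 1) isOpen_Ioo hw d1
      continuous_const t ht
  have dH1 : ∀ t ∈ Ioo r 1, HasDerivAt H1 (H2 t) t := by
    intro t ht
    have := avg_deriv2 r h hh.1 (fun s => s • ee 0) (fun _ => ee 0) (fun _ => 0) (Ioo r 1)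
      isOpen_Ioo hw d1 (fun t => hasDerivAt_const t _) continuous_const t ht
    simp only [map_zero, add_zero] at this
    exact this
  have ode : ∀ t ∈ Ioo r 1, t * H2 t + 3 * H1 t = 0 := by
    intro t ht
    have hi := fun i => intGQ (cont_D2 r h hh.1 (t • ee 0) (ee i) (hw t ht))
    have hsum : ∑ i : Fin 4, ∫ p, fderiv ℝ (fderiv ℝ h) (act p (t • ee 0)) (act p (ee i)) (act p (ee i)) ∂muG = 0 := by
      rw [← integral_finsetSum _ (fun i _ => hi i)]
      have : ∀ p : GQ, ∑ i : Fin 4, fderiv ℝ (fderiv ℝ h) (act p (t • ee 0)) (act p (ee i)) (act p (ee i)) = 0 :=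
        fun p => trace_act r h hh _ (by
          have := hw t ht
          simpa only [Ann, mem_setOf_eq, norm_act] using this) p
      simp only [this, integral_zero]
    rw [Fin.sum_univ_four] at hsum
    have c := fun i hi => circle_identity r h hh.1 t hr ht.1 ht.2 i hi
    have c1 := c 1 (by decide)
    have c2 := c 2 (by decide)
    have c3 := c 3 (by decide)
    simp only [H1, H2]
    have := congrArg (fun z => t * z) hsum
    simp only [mul_add, mul_zero] at this
    rw [c1, c2, c3] at this
    linarith
  have hpre : IsPreconnected (Ioo r 1) := isPreconnected_Ioo
  obtain ⟨k, hk⟩ : ∃ k, ∀ t ∈ Ioo r 1, t ^ 3 * H1 t = k := by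
    have hder : ∀ t ∈ Ioo r 1, HasDerivAt (fun t => t ^ 3 * H1 t) 0 t := by
      intro t ht
      have := (hasDerivAt_pow 3 t).mul (dH1 t ht)
      refine this.congr_deriv ?_
      have o := ode t ht
      have : (3:ℝ) * t ^ 2 * H1 t + t ^ 3 * H2 t = t ^ 2 * (t * H2 t + 3 * H1 t) := by ring
      rw [o] at this
      norm_num
      linarith
    refine isOpen_Ioo.exists_is_const_of_deriv_eq_zero hpre
      (fun t ht => (hder t ht).differentiableAt.differentiableWithinAt) ?_
    intro t ht
    exact (hder t ht).deriv
  obtain ⟨A, hA⟩ : ∃ A, ∀ t ∈ Ioo r 1, H t + k / 2 * (t ^ 2)⁻¹ = A := by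
    have hder : ∀ t ∈ Ioo r 1, HasDerivAt (fun t => H t + k / 2 * (t ^ 2)⁻¹) 0 t := by
      intro t ht
      have t0 : t ≠ 0 := (hr.trans ht.1).ne'
      have := (dH t ht).add (((hasDerivAt_pow 2 t).inv (pow_ne_zero 2 t0)).const_mul (k / 2))
      refine this.congr_deriv ?_
      rw [← hk t ht]
      field_simp
      norm_num
      right; ring
    refine isOpen_Ioo.exists_is_const_of_deriv_eq_zero hpre
      (fun t ht => (hder t ht).differentiableAt.differentiableWithinAt) ?_
    intro t ht
    exact (hder t ht).deriv
  have hHc : ContinuousOn H (Icc r 1) := by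
    have hcomp : IsCompact {x : E4 | r ≤ ‖x‖ ∧ ‖x‖ ≤ 1} := by
      refine (isCompact_closedBall (0:E4) 1).of_isClosed_subset ?_ ?_
      · exact (isClosed_le continuous_const continuous_norm).inter
          (isClosed_le continuous_norm continuous_const)
      · intro x hx; simpa using hx.2
    obtain ⟨M, hM⟩ := hcomp.exists_bound_of_continuousOn hc
    have hmem : ∀ t ∈ Icc r 1, ∀ p, act p (t • ee 0) ∈ {x : E4 | r ≤ ‖x‖ ∧ ‖x‖ ≤ 1} := by
      intro t ht p
      simp only [mem_setOf_eq, norm_act, hn t (hr.trans_le ht.1)]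
      exact ht
    simp only [H, avg_def]
    refine continuousOn_of_dominated (bound := fun _ => M) ?_ ?_ (integrable_const _) ?_
    · intro t ht
      refine Continuous.aestronglyMeasurable ?_
      rw [← continuousOn_univ]
      exact hc.comp (cont_act continuous_id continuous_const).continuousOn (fun p _ => hmem t ht p)
    · intro t ht
      exact Eventually.of_forall fun p => hM _ (hmem t ht p)
    · refine Eventually.of_forall fun p => ?_
      refine hc.comp (f := fun t : ℝ => act p (t • ee 0)) ?_ (fun t ht => hmem t ht p)
      exact (cont_act continuous_const (by fun_prop)).continuousOn
  have hEq : EqOn H (fun t => A + (-(k/2)) * (t ^ 2)⁻¹) (Icc r 1) := by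
    refine EqOn.of_subset_closure (s := Ioo r 1) ?_ hHc ?_ Ioo_subset_Icc_self ?_
    · intro t ht
      have := hA t ht
      simp only
      linarith
    · refine continuousOn_const.add (continuousOn_const.mul (ContinuousOn.inv₀ (by fun_prop) ?_))
      intro t ht
      exact pow_ne_zero 2 (hr.trans_le ht.1).ne'
    · rw [closure_Ioo hr1.ne]
  refine ⟨A, -(k/2), fun x hx1 hx2 => ?_⟩
  have := hEq (⟨hx1, hx2⟩ : ‖x‖ ∈ Icc r 1)
  rw [avg_radial h x (‖x‖ • ee 0) (by rw [hn _ (hr.trans_le hx1)])]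
  exact this


/-- partial derivative -/
def Dd (i : Fin 4) (f : E4 → ℝ) (x : E4) : ℝ := fderiv ℝ f x (ee i)

lemma tsupport_Dd (i : Fin 4) (f : E4 → ℝ) : tsupport (Dd i f) ⊆ tsupport f :=
  tsupport_fderiv_apply_subset ℝ (ee i)

lemma contDiff_Dd (i : Fin 4) (f : E4 → ℝ) (n : WithTop ℕ∞) (hf : ContDiff ℝ (n + 1) f) :
    ContDiff ℝ n (Dd i f) := by
  have := hf.fderiv_right (m := n) le_rfl
  exact this.clm_apply contDiff_const

lemma int_mul (U : Set E4) (hU : IsOpen U) (f g : E4 → ℝ) (hf : ContinuousOn f U)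
    (hg : Continuous g) (hs : HasCompactSupport g) (ht : tsupport g ⊆ U) :
    Integrable (fun x => f x * g x) := by
  have h1 : tsupport (fun x => f x * g x) ⊆ tsupport g := tsupport_mul_subset_right
  refine Continuous.integrable_of_hasCompactSupport ?_ hs.mul_left
  exact (hf.mul hg.continuousOn).continuous_of_tsupport_subset hU (h1.trans ht)

lemma ibp (U : Set E4) (hU : IsOpen U) (f g : E4 → ℝ) (hf : ContDiffOn ℝ 1 f U)
    (hg : ContDiff ℝ 1 g) (hs : HasCompactSupport g) (ht : tsupport g ⊆ U) (i : Fin 4) :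
    ∫ x, f x * Dd i g x = - ∫ x, Dd i f x * g x := by
  refine integral_mul_fderiv_eq_neg_fderiv_mul_of_integrable ?_ ?_ ?_ ?_ ?_
  · refine int_mul U hU _ _ ?_ hg.continuous hs ht
    exact (hf.continuousOn_fderiv_of_isOpen hU le_rfl).clm_apply continuousOn_const
  · refine int_mul U hU _ (Dd i g) hf.continuousOn ?_ ?_ ((tsupport_Dd i g).trans ht)
    · exact (contDiff_Dd i g 0 (by simpa using hg)).continuous
    · exact hs.of_isClosed_subset (isClosed_tsupport _) (tsupport_Dd i g)
  · exact int_mul U hU _ _ hf.continuousOn hg.continuous hs ht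
  · intro x hx
    exact (hf.contDiffAt (hU.mem_nhds (ht hx))).differentiableAt (by norm_num)
  · intro x _
    exact hg.differentiable (by norm_num) x

lemma weak_harm (r : ℝ) (h ψ : E4 → ℝ) (hh : IsHarmonicOn h (Ann r))
    (hψ : ContDiff ℝ 2 ψ) (hs : HasCompactSupport ψ) (ht : tsupport ψ ⊆ Ann r) :
    ∫ x, h x * ∑ i, Dd i (Dd i ψ) x = 0 := by
  have hU := isOpen_Ann r
  have hs1 : ∀ i, HasCompactSupport (Dd i ψ) := fun i =>
    hs.of_isClosed_subset (isClosed_tsupport _) (tsupport_Dd i ψ)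
  have ht1 : ∀ i, tsupport (Dd i ψ) ⊆ Ann r := fun i => (tsupport_Dd i ψ).trans ht
  have hs2 : ∀ i, HasCompactSupport (Dd i (Dd i ψ)) := fun i =>
    (hs1 i).of_isClosed_subset (isClosed_tsupport _) (tsupport_Dd i _)
  have ht2 : ∀ i, tsupport (Dd i (Dd i ψ)) ⊆ Ann r := fun i => (tsupport_Dd i _).trans (ht1 i)
  have c1 : ∀ i, ContDiff ℝ 1 (Dd i ψ) := fun i => contDiff_Dd i ψ 1 (by
    simpa [one_add_one_eq_two] using hψ)
  have c2 : ∀ i, Continuous (Dd i (Dd i ψ)) := fun i => (contDiff_Dd i _ 0 (by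
    simpa using c1 i)).continuous
  have hD1 : ∀ i, ContDiffOn ℝ 1 (Dd i h) (Ann r) := fun i =>
    (hh.1.fderiv_of_isOpen hU (by norm_num : (1:WithTop ℕ∞) + 1 ≤ 2)).clm_apply contDiffOn_const
  have hD2 : ∀ i, ContinuousOn (Dd i (Dd i h)) (Ann r) := fun i =>
    ((hD1 i).continuousOn_fderiv_of_isOpen hU le_rfl).clm_apply continuousOn_const
  have key : ∀ i, ∫ x, h x * Dd i (Dd i ψ) x = ∫ x, Dd i (Dd i h) x * ψ x := by
    intro i
    rw [ibp _ hU h (Dd i ψ) (hh.1.of_le (by norm_num)) (c1 i) (hs1 i) (ht1 i),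
      ibp _ hU (Dd i h) ψ (hD1 i) (hψ.of_le (by norm_num)) hs ht, neg_neg]
  simp only [Finset.mul_sum]
  rw [integral_finsetSum]
  · simp only [key]
    rw [← integral_finsetSum]
    · refine integral_eq_zero_of_ae (Eventually.of_forall fun x => ?_)
      beta_reduce
      rw [← Finset.sum_mul]
      by_cases hx : x ∈ Ann r
      · have := hh.2 x hx
        simp only [Pi.zero_apply]
        rw [show ∑ i, Dd i (Dd i h) x = 0 from this, zero_mul]
      · have : ψ x = 0 := by
          by_contra h0
          exact hx (ht (subset_tsupport _ h0))
        simp [this]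
    · intro i _
      exact int_mul _ hU _ _ (hD2 i) hψ.continuous hs ht
  · intro i _
    exact int_mul _ hU _ _ hh.1.continuousOn (c2 i) (hs2 i) (ht2 i)

lemma Dd_of {f : E4 → ℝ} {L : E4 →L[ℝ] ℝ} {x : E4} (i : Fin 4) (h : HasFDerivAt f L x) :
    Dd i f x = L (ee i) := by rw [Dd, h.fderiv]

/-- regularised fundamental solution -/
def Gam (ε : ℝ) (x y : E4) : ℝ := (‖x - y‖ ^ 2 + ε)⁻¹

lemma Gam_pos' (ε : ℝ) (hε : 0 < ε) (x y : E4) : 0 < ‖x - y‖ ^ 2 + ε := by positivity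

lemma contDiff_Gam (ε : ℝ) (hε : 0 < ε) (x : E4) (n : WithTop ℕ∞) : ContDiff ℝ n (Gam ε x) := by
  refine ContDiff.inv ?_ (fun y => (Gam_pos' ε hε x y).ne')
  exact ((contDiff_const.sub contDiff_id).norm_sq ℝ).add contDiff_const

lemma hasFDerivAt_base (ε : ℝ) (x y : E4) (i : Fin 4) :
    HasFDerivAt (fun y : E4 => ‖x - y‖ ^ 2 + ε) ((-2:ℝ) • (innerSL ℝ (x - y))) y := by
  have h := ((hasFDerivAt_id y).const_sub x).norm_sq
  refine (h.add_const ε).congr_fderiv ?_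
  ext v
  simp
  ring

lemma inner_ee (z : E4) (i : Fin 4) : inner ℝ z (ee i) = z i := by
  simp [ee, EuclideanSpace.inner_single_right]

lemma Dd_Gam (ε : ℝ) (hε : 0 < ε) (x : E4) (i : Fin 4) :
    Dd i (Gam ε x) = fun y => 2 * (x i - y i) * (Gam ε x y) ^ 2 := by
  funext y
  have h := (hasFDerivAt_base ε x y i)
  have h2 := (hasDerivAt_inv (Gam_pos' ε hε x y).ne').comp_hasFDerivAt y h
  refine (Dd_of i h2).trans ?_
  simp only [ContinuousLinearMap.smul_apply, innerSL_apply_apply, inner_ee, Gam, smul_eq_mul, PiLp.sub_apply]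
  field_simp

lemma hasFDerivAt_coord (x y : E4) (i : Fin 4) :
    HasFDerivAt (fun y : E4 => 2 * (x i - y i)) ((-2:ℝ) • (EuclideanSpace.proj i : E4 →L[ℝ] ℝ)) y := by
  have h := ((EuclideanSpace.proj i : E4 →L[ℝ] ℝ).hasFDerivAt (x := y))
  refine ((h.const_sub (x i)).const_mul 2).congr_fderiv ?_
  ext v
  simp

lemma DDd_Gam (ε : ℝ) (hε : 0 < ε) (x y : E4) (i : Fin 4) :
    Dd i (Dd i (Gam ε x)) y = -2 * (Gam ε x y) ^ 2 + 8 * (x i - y i) ^ 2 * (Gam ε x y) ^ 3 := by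
  have hG : HasFDerivAt (Gam ε x) (fderiv ℝ (Gam ε x) y) y :=
    ((contDiff_Gam ε hε x 1).differentiable (by norm_num) y).hasFDerivAt
  have h := (hasFDerivAt_coord x y i).mul (hG.pow 2)
  have e : fderiv ℝ (Gam ε x) y (ee i) = 2 * (x i - y i) * (Gam ε x y) ^ 2 := congrFun (Dd_Gam ε hε x i) y
  rw [Dd_Gam ε hε x i]
  refine (Dd_of i h).trans ?_
  simp only [ContinuousLinearMap.add_apply, ContinuousLinearMap.smul_apply, smul_eq_mul, e]
  simp [ee]
  ring

lemma lap_Gam (ε : ℝ) (hε : 0 < ε) (x y : E4) :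
    ∑ i, Dd i (Dd i (Gam ε x)) y = - (8 * ε * (Gam ε x y) ^ 3) := by
  simp only [DDd_Gam ε hε]
  have hn : ‖x - y‖ ^ 2 = ∑ i, (x i - y i) ^ 2 := by
    rw [EuclideanSpace.norm_sq_eq]; simp
  have hp := (Gam_pos' ε hε x y).ne'
  rw [Finset.sum_add_distrib, ← Finset.sum_mul (f := fun i => 8 * (x i - y i) ^ 2), ← Finset.mul_sum (f := fun i => (x i - y i) ^ 2),
    ← hn]
  have hg : Gam ε x y * (‖x - y‖ ^ 2 + ε) = 1 := inv_mul_cancel₀ hp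
  simp only [Finset.sum_const, Finset.card_univ, Fintype.card_fin, nsmul_eq_mul]
  push_cast
  linear_combination 8 * (Gam ε x y) ^ 2 * hg

lemma Dd_mul (f g : E4 → ℝ) (hf : ContDiff ℝ 1 f) (hg : ContDiff ℝ 1 g) (i : Fin 4) :
    Dd i (fun x => f x * g x) = fun x => f x * Dd i g x + Dd i f x * g x := by
  funext x
  have := ((hf.differentiable (by norm_num) x).hasFDerivAt).mul
    ((hg.differentiable (by norm_num) x).hasFDerivAt)
  refine (Dd_of i this).trans ?_
  simp [Dd]
  ring

lemma Dd_add (f g : E4 → ℝ) (hf : ContDiff ℝ 1 f) (hg : ContDiff ℝ 1 g) (i : Fin 4) :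
    Dd i (fun x => f x + g x) = fun x => Dd i f x + Dd i g x := by
  funext x
  have := ((hf.differentiable (by norm_num) x).hasFDerivAt).add
    ((hg.differentiable (by norm_num) x).hasFDerivAt)
  refine (Dd_of i this).trans ?_
  simp [Dd]

lemma Dd_sub (f g : E4 → ℝ) (hf : ContDiff ℝ 1 f) (hg : ContDiff ℝ 1 g) (i : Fin 4) :
    Dd i (fun x => f x - g x) = fun x => Dd i f x - Dd i g x := by
  funext x
  have := ((hf.differentiable (by norm_num) x).hasFDerivAt).sub
    ((hg.differentiable (by norm_num) x).hasFDerivAt)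
  refine (Dd_of i this).trans ?_
  simp [Dd]

lemma DDd_mul (f g : E4 → ℝ) (hf : ContDiff ℝ 2 f) (hg : ContDiff ℝ 2 g) (i : Fin 4) (x : E4) :
    Dd i (Dd i (fun x => f x * g x)) x =
      f x * Dd i (Dd i g) x + 2 * (Dd i f x * Dd i g x) + Dd i (Dd i f) x * g x := by
  have f1 : ContDiff ℝ 1 f := hf.of_le (by norm_num)
  have g1 : ContDiff ℝ 1 g := hg.of_le (by norm_num)
  have f2 := contDiff_Dd i f 1 (by simpa [one_add_one_eq_two] using hf)
  have g2 := contDiff_Dd i g 1 (by simpa [one_add_one_eq_two] using hg)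
  rw [Dd_mul f g f1 g1 i, Dd_add _ _ (f1.mul g2) (f2.mul g1), Dd_mul _ _ f1 g2, Dd_mul _ _ f2 g1]
  ring

/-- the operator appearing when commuting the Laplacian with a cutoff -/
def Comm (η : E4 → ℝ) (ε q : ℝ) (x y : E4) : ℝ :=
  ∑ i, (2 * (Dd i η y * Dd i (Gam ε x) y) + Dd i (Dd i η) y * (Gam ε x y - q))

lemma lap_mul (ε : ℝ) (hε : 0 < ε) (x y : E4) (η : E4 → ℝ) (hη : ContDiff ℝ 2 η) :
    ∑ i, Dd i (Dd i (fun y => η y * Gam ε x y)) y =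
      - (8 * ε * (Gam ε x y) ^ 3 * η y) + Comm η ε 0 x y := by
  simp only [DDd_mul η (Gam ε x) hη (contDiff_Gam ε hε x 2), Comm, sub_zero]
  simp only [add_assoc, Finset.sum_add_distrib]
  rw [← Finset.mul_sum, lap_Gam ε hε]
  ring

lemma Comm_sub (ε q : ℝ) (x y : E4) (η ζ : E4 → ℝ) (hη : ContDiff ℝ 2 η) (hζ : ContDiff ℝ 2 ζ) :
    Comm (fun y => η y - ζ y) ε q x y = Comm η ε q x y - Comm ζ ε q x y := by
  have f1 : ContDiff ℝ 1 η := hη.of_le (by norm_num)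
  have g1 : ContDiff ℝ 1 ζ := hζ.of_le (by norm_num)
  have f2 := fun i => contDiff_Dd i η 1 (by simpa [one_add_one_eq_two] using hη)
  have g2 := fun i => contDiff_Dd i ζ 1 (by simpa [one_add_one_eq_two] using hζ)
  simp only [Comm, Dd_sub η ζ f1 g1, fun i => Dd_sub _ _ (f2 i) (g2 i) i]
  rw [← Finset.sum_sub_distrib]
  exact Finset.sum_congr rfl fun i _ => by ring

lemma Comm_q (ε q : ℝ) (x y : E4) (η : E4 → ℝ) :
    Comm η ε 0 x y = Comm η ε q x y + q * ∑ i, Dd i (Dd i η) y := by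
  simp only [Comm]
  rw [Finset.mul_sum, ← Finset.sum_add_distrib]
  exact Finset.sum_congr rfl fun i _ => by ring

lemma continuous_Comm (ε q : ℝ) (hε : 0 < ε) (x : E4) (η : E4 → ℝ) (hη : ContDiff ℝ 2 η) :
    Continuous (Comm η ε q x) := by
  have f2 := fun i => contDiff_Dd i η 1 (by simpa [one_add_one_eq_two] using hη)
  have f3 := fun i => (contDiff_Dd i (Dd i η) 0 (by simpa using f2 i)).continuous
  have g2 := fun i => (contDiff_Dd i _ 1 (contDiff_Gam ε hε x (1 + 1))).continuous
  have g1 := (contDiff_Gam ε hε x 1).continuous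
  refine continuous_finset_sum _ fun i _ => ?_
  exact (continuous_const.mul ((f2 i).continuous.mul (g2 i))).add
    ((f3 i).mul (g1.sub continuous_const))

/-- a fixed bump function -/
def thB : ContDiffBump (0 : E4) := ⟨5/4, 3/2, by norm_num, by norm_num⟩

/-- rescaled cutoff -/
def cut (s : ℝ) (y : E4) : ℝ := thB (s⁻¹ • y)

lemma contDiff_thB : ContDiff ℝ 3 thB := thB.contDiff

lemma contDiff_cut (s : ℝ) : ContDiff ℝ 2 (cut s) :=
  (contDiff_thB.of_le (by norm_num)).comp (contDiff_const_smul s⁻¹)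

lemma norm_inv_smul (s : ℝ) (hs : 0 < s) (y : E4) : ‖s⁻¹ • y‖ = ‖y‖ / s := by
  rw [norm_smul, norm_inv, Real.norm_eq_abs, abs_of_pos hs]; field_simp

lemma cut_one (s : ℝ) (hs : 0 < s) (y : E4) (hy : ‖y‖ ≤ 5/4 * s) : cut s y = 1 := by
  refine thB.one_of_mem_closedBall ?_
  rw [mem_closedBall_zero_iff, norm_inv_smul s hs, div_le_iff₀ hs]
  exact hy

lemma cut_zero (s : ℝ) (hs : 0 < s) (y : E4) (hy : 3/2 * s ≤ ‖y‖) : cut s y = 0 := by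
  refine thB.zero_of_le_dist ?_
  rw [dist_zero_right, norm_inv_smul s hs, le_div_iff₀ hs]
  exact hy

lemma Dd_comp_smul (f : E4 → ℝ) (hf : ContDiff ℝ 1 f) (c : ℝ) (i : Fin 4) :
    Dd i (fun y => f (c • y)) = fun y => c * Dd i f (c • y) := by
  funext y
  have h1 : HasFDerivAt (fun y : E4 => c • y) (c • ContinuousLinearMap.id ℝ E4) y :=
    (hasFDerivAt_id y).const_smul c
  have h2 := ((hf.differentiable (by norm_num) (c • y)).hasFDerivAt).comp y h1
  refine (Dd_of i h2).trans ?_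
  simp [Dd]

lemma Dd_const_mul (f : E4 → ℝ) (hf : ContDiff ℝ 1 f) (c : ℝ) (i : Fin 4) :
    Dd i (fun y => c * f y) = fun y => c * Dd i f y := by
  funext y
  have h2 := ((hf.differentiable (by norm_num) y).hasFDerivAt).const_mul c
  refine (Dd_of i h2).trans ?_
  simp [Dd]

lemma Dd_cut (s : ℝ) (i : Fin 4) : Dd i (cut s) = fun y => s⁻¹ * Dd i thB (s⁻¹ • y) :=
  Dd_comp_smul thB (contDiff_thB.of_le (by norm_num)) s⁻¹ i

lemma DDd_cut (s : ℝ) (i : Fin 4) :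
    Dd i (Dd i (cut s)) = fun y => s⁻¹ * (s⁻¹ * Dd i (Dd i thB) (s⁻¹ • y)) := by
  have h1 : ContDiff ℝ 1 (Dd i thB) := contDiff_Dd i _ 1 (contDiff_thB.of_le (by
    rw [one_add_one_eq_two]; norm_num))
  rw [Dd_cut, Dd_const_mul (fun y => Dd i thB (s⁻¹ • y)) (h1.comp (contDiff_const_smul s⁻¹)),
    Dd_comp_smul _ h1]

lemma exists_M : ∃ M : ℝ, 0 < M ∧ ∀ s : ℝ, 0 < s → ∀ i y,
    |Dd i (cut s) y| ≤ M / s ∧ |Dd i (Dd i (cut s)) y| ≤ M / s ^ 2 := by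
  have h1 : ∀ i, ContDiff ℝ 1 (Dd i thB) := fun i => contDiff_Dd i _ 1 (contDiff_thB.of_le (by
    rw [one_add_one_eq_two]; norm_num))
  have c1 : ∀ i, Continuous (Dd i thB) := fun i => (h1 i).continuous
  have c2 : ∀ i, Continuous (Dd i (Dd i thB)) := fun i =>
    (contDiff_Dd i _ 0 (by simpa using h1 i)).continuous
  have hs := thB.hasCompactSupport
  have s1 : ∀ i, HasCompactSupport (Dd i thB) := fun i =>
    hs.of_isClosed_subset (isClosed_tsupport _) (tsupport_Dd i _)
  have s2 : ∀ i, HasCompactSupport (Dd i (Dd i thB)) := fun i =>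
    (s1 i).of_isClosed_subset (isClosed_tsupport _) (tsupport_Dd i _)
  choose C1 hC1 using fun i => (s1 i).exists_bound_of_continuous (c1 i)
  choose C2 hC2 using fun i => (s2 i).exists_bound_of_continuous (c2 i)
  have p1 : ∀ i, 0 ≤ C1 i := fun i => (norm_nonneg _).trans (hC1 i 0)
  have p2 : ∀ i, 0 ≤ C2 i := fun i => (norm_nonneg _).trans (hC2 i 0)
  refine ⟨1 + ∑ i, C1 i + ∑ i, C2 i, ?_, ?_⟩
  · have := Finset.sum_nonneg (s := Finset.univ) fun i _ => p1 i
    have := Finset.sum_nonneg (s := Finset.univ) fun i _ => p2 i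
    linarith
  intro s hs i y
  have q1 := Finset.single_le_sum (s := Finset.univ) (fun i _ => p1 i) (Finset.mem_univ i)
  have q2 := Finset.single_le_sum (s := Finset.univ) (fun i _ => p2 i) (Finset.mem_univ i)
  have q3 := Finset.sum_nonneg (s := Finset.univ) fun i _ => p1 i
  have q4 := Finset.sum_nonneg (s := Finset.univ) fun i _ => p2 i
  rw [DDd_cut, Dd_cut]
  have b1 := hC1 i (s⁻¹ • y)
  have b2 := hC2 i (s⁻¹ • y)
  rw [Real.norm_eq_abs] at b1 b2
  constructor
  · rw [abs_mul, abs_inv, abs_of_pos hs, inv_mul_eq_div]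
    gcongr; linarith
  · beta_reduce
    rw [← mul_assoc, abs_mul, ← mul_inv, ← sq, abs_inv, abs_of_pos (pow_pos hs 2), inv_mul_eq_div]
    gcongr; linarith

lemma Dd_zero_of_eqOn (f : E4 → ℝ) (U : Set E4) (hU : IsOpen U) (c : ℝ) (hf : ∀ y ∈ U, f y = c)
    (i : Fin 4) : ∀ y ∈ U, Dd i f y = 0 := by
  intro y hy
  have : f =ᶠ[nhds y] fun _ => c := by
    filter_upwards [hU.mem_nhds hy] with z hz using hf z hz
  rw [Dd, this.fderiv_eq]
  simp

/-- support shell of the derivative of the cutoff -/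
def Shell (s : ℝ) : Set E4 := {y | 5/4 * s ≤ ‖y‖ ∧ ‖y‖ ≤ 3/2 * s}

lemma isClosed_Shell (s : ℝ) : IsClosed (Shell s) :=
  (isClosed_le continuous_const continuous_norm).inter
          (isClosed_le continuous_norm continuous_const)

lemma isCompact_Shell (s : ℝ) : IsCompact (Shell s) := by
  refine (isCompact_closedBall (0:E4) (3/2*s)).of_isClosed_subset (isClosed_Shell s) ?_
  intro x hx; simpa using hx.2

lemma Dd_cut_zero (s : ℝ) (hs : 0 < s) (i : Fin 4) (y : E4) (hy : y ∉ Shell s) :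
    Dd i (cut s) y = 0 ∧ Dd i (Dd i (cut s)) y = 0 := by
  have hU1 : IsOpen {y : E4 | ‖y‖ < 5/4 * s} := isOpen_lt continuous_norm continuous_const
  have hU2 : IsOpen {y : E4 | 3/2 * s < ‖y‖} := isOpen_lt continuous_const continuous_norm
  have a1 := Dd_zero_of_eqOn (cut s) _ hU1 1 (fun y hy => cut_one s hs y (le_of_lt hy)) i
  have a2 := Dd_zero_of_eqOn (cut s) _ hU2 0 (fun y hy => cut_zero s hs y (le_of_lt hy)) i
  have b1 := Dd_zero_of_eqOn _ _ hU1 0 a1 i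
  have b2 := Dd_zero_of_eqOn _ _ hU2 0 a2 i
  by_cases h1 : ‖y‖ < 5/4 * s
  · exact ⟨a1 y h1, b1 y h1⟩
  · have h2 : 3/2 * s < ‖y‖ := by
      by_contra h3
      exact hy ⟨not_lt.1 h1, not_lt.1 h3⟩
    exact ⟨a2 y h2, b2 y h2⟩

lemma Comm_cut_zero (s : ℝ) (hs : 0 < s) (ε q : ℝ) (x y : E4) (hy : y ∉ Shell s) :
    Comm (cut s) ε q x y = 0 := by
  simp [Comm, fun i => (Dd_cut_zero s hs i y hy).1, fun i => (Dd_cut_zero s hs i y hy).2]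

lemma lap_cut_zero (s : ℝ) (hs : 0 < s) (y : E4) (hy : y ∉ Shell s) :
    ∑ i, Dd i (Dd i (cut s)) y = 0 := by
  simp [fun i => (Dd_cut_zero s hs i y hy).2]

lemma continuous_lap_cut (s : ℝ) : Continuous (fun y => ∑ i, Dd i (Dd i (cut s)) y) := by
  refine continuous_finset_sum _ fun i _ => ?_
  have f2 := contDiff_Dd i (cut s) 1 (by simpa [one_add_one_eq_two] using contDiff_cut s)
  exact (contDiff_Dd i _ 0 (by simpa using f2)).continuous

lemma tsupport_shell (s : ℝ) (F : E4 → ℝ) (hF : ∀ y, y ∉ Shell s → F y = 0) :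
    tsupport F ⊆ Shell s := by
  refine closure_minimal ?_ (isClosed_Shell s)
  intro y hy
  by_contra h
  exact hy (hF y h)

lemma int_shell (r s : ℝ) (h F : E4 → ℝ) (hh : ContinuousOn h (Ann r)) (hS : Shell s ⊆ Ann r)
    (hF : Continuous F) (hF0 : ∀ y, y ∉ Shell s → F y = 0) :
    Integrable (fun y => h y * F y) :=
  int_mul _ (isOpen_Ann r) h F hh hF
    ((isCompact_Shell s).of_isClosed_subset (isClosed_tsupport _) (tsupport_shell s F hF0))
    ((tsupport_shell s F hF0).trans hS)

/-- the cutoff to the annulus -/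
def chi (r : ℝ) (y : E4) : ℝ := cut (3/5) y - cut r y

lemma kernel_identity (r : ℝ) (hr : 0 < r) (hr8 : r < 1/8) (h : E4 → ℝ)
    (hh : IsHarmonicOn h (Ann r)) (ε : ℝ) (hε : 0 < ε) (x : E4) :
    ∫ y, h y * (8 * ε * (Gam ε x y) ^ 3 * chi r y) =
      (∫ y, h y * Comm (cut (3/5)) ε 0 x y) - ∫ y, h y * Comm (cut r) ε 0 x y := by
  have hc1 := contDiff_cut (3/5)
  have hc2 := contDiff_cut r
  have hchi : ContDiff ℝ 2 (chi r) := hc1.sub hc2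
  have S1 : Shell (3/5) ⊆ Ann r := fun y hy => ⟨by linarith [hy.1], by linarith [hy.2]⟩
  have S2 : Shell r ⊆ Ann r := fun y hy => ⟨by linarith [hy.1], by linarith [hy.2]⟩
  have i1 := int_shell r (3/5) h _ hh.1.continuousOn S1 (continuous_Comm ε 0 hε x _ hc1)
    (fun y hy => Comm_cut_zero _ (by norm_num) ε 0 x y hy)
  have i2 := int_shell r r h _ hh.1.continuousOn S2 (continuous_Comm ε 0 hε x _ hc2)
    (fun y hy => Comm_cut_zero _ hr ε 0 x y hy)
  let T : Set E4 := {y | 5/4 * r ≤ ‖y‖ ∧ ‖y‖ ≤ 9/10}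
  have hT : IsClosed T := (isClosed_le continuous_const continuous_norm).inter
          (isClosed_le continuous_norm continuous_const)
  have hTc : IsCompact T := by
    refine (isCompact_closedBall (0:E4) (9/10)).of_isClosed_subset hT ?_
    intro x hx; simpa using hx.2
  have hTA : T ⊆ Ann r := fun y hy => ⟨by linarith [hy.1], by linarith [hy.2]⟩
  have hz : ∀ y, y ∉ T → chi r y = 0 := by
    intro y hy
    by_cases h1 : ‖y‖ < 5/4 * r
    · rw [chi, cut_one _ (by norm_num) y (by linarith), cut_one r hr y h1.le, sub_self]
    · have h2 : 9/10 < ‖y‖ := by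
        by_contra h3
        exact hy ⟨not_lt.1 h1, not_lt.1 h3⟩
      rw [chi, cut_zero _ (by norm_num) y (by linarith), cut_zero r hr y (by linarith), sub_self]
  have hts : ∀ F : E4 → ℝ, (∀ y, y ∉ T → F y = 0) → tsupport F ⊆ T := by
    intro F hF
    refine closure_minimal ?_ hT
    intro y hy
    by_contra h
    exact hy (hF y h)
  have hG := contDiff_Gam ε hε x 2
  have hts1 := hts (fun y => chi r y * Gam ε x y) (fun y hy => by simp [hz y hy])
  have hw := weak_harm r h (fun y => chi r y * Gam ε x y) hh (hchi.mul hG)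
    (hTc.of_isClosed_subset (isClosed_tsupport _) hts1) (hts1.trans hTA)
  simp only [lap_mul ε hε x _ (chi r) hchi] at hw
  have hcs : ∀ y, Comm (chi r) ε 0 x y = Comm (cut (3/5)) ε 0 x y - Comm (cut r) ε 0 x y :=
    fun y => Comm_sub ε 0 x y _ _ hc1 hc2
  have hts2 := hts (fun y => 8 * ε * (Gam ε x y) ^ 3 * chi r y) (fun y hy => by simp [hz y hy])
  have i3 := int_mul _ (isOpen_Ann r) h (fun y => 8 * ε * (Gam ε x y) ^ 3 * chi r y)
    hh.1.continuousOn (by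
      have := hG.continuous
      have := hchi.continuous
      fun_prop) (hTc.of_isClosed_subset (isClosed_tsupport _) hts2) (hts2.trans hTA)
  have : ∀ y, h y * (-(8 * ε * Gam ε x y ^ 3 * chi r y) + Comm (chi r) ε 0 x y) =
      (h y * Comm (cut (3/5)) ε 0 x y - h y * Comm (cut r) ε 0 x y) -
        h y * (8 * ε * Gam ε x y ^ 3 * chi r y) := by
    intro y; rw [hcs]; ring
  simp only [this] at hw
  have i12 : Integrable fun y => h y * Comm (cut (3/5)) ε 0 x y - h y * Comm (cut r) ε 0 x y :=
    i1.sub i2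
  rw [integral_sub i12 i3, integral_sub i1 i2] at hw
  linarith

/-- the profile -/
def phi0 (z : E4) : ℝ := 8 * ((1 + ‖z‖ ^ 2)⁻¹) ^ 3

/-- its mass -/
def c0 : ℝ := ∫ z, phi0 z

lemma phi0_pos (z : E4) : 0 < phi0 z := by unfold phi0; positivity

lemma continuous_phi0 : Continuous phi0 := by
  unfold phi0
  refine continuous_const.mul (Continuous.pow (Continuous.inv₀ (by fun_prop) ?_) 3)
  intro z; positivity

lemma integrable_phi0 : Integrable phi0 := by
  have h := integrable_rpow_neg_one_add_norm_sq (E := E4) (μ := volume) (r := 6) (by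
    rw [finrank_euclideanSpace_fin]; norm_num)
  refine (h.const_mul 8).congr (Eventually.of_forall fun z => ?_)
  simp only [phi0]
  congr 1
  rw [show (-6/2 : ℝ) = ((-3 : ℤ) : ℝ) by norm_num, Real.rpow_intCast, zpow_neg, inv_pow]
  rfl

lemma c0_pos : 0 < c0 := by
  refine (integral_pos_iff_support_of_nonneg (fun z => (phi0_pos z).le) integrable_phi0).2 ?_
  have : Function.support phi0 = univ := by
    ext z; simp [(phi0_pos z).ne']
  rw [this]
  simp

lemma scale_phi0 (c : ℝ) (hc : 0 < c) (x y : E4) :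
    c ^ 4 * phi0 (c • (x - y)) = 8 * (c ^ 2)⁻¹ * Gam ((c ^ 2)⁻¹) x y ^ 3 := by
  simp only [phi0, Gam, norm_smul, Real.norm_eq_abs, abs_of_pos hc]
  have h1 : (1 + (c * ‖x - y‖) ^ 2) = c ^ 2 * (‖x - y‖ ^ 2 + (c ^ 2)⁻¹) := by
    field_simp
    ring
  rw [h1, mul_inv, mul_pow]
  field_simp

lemma tendsto_kernel (r : ℝ) (hr : 0 < r) (hr8 : r < 1/8) (h : E4 → ℝ)
    (hh : ContinuousOn h (Ann r)) (x : E4) (hx1 : 2 * r ≤ ‖x‖) (hx2 : ‖x‖ ≤ 5/8) :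
    Tendsto (fun c : ℝ => ∫ y, h y * (8 * (c ^ 2)⁻¹ * (Gam (c ^ 2)⁻¹ x y) ^ 3 * chi r y)) atTop
      (nhds (c0 * h x)) := by
  have hx : x ∈ Ann r := ⟨by linarith, by linarith⟩
  let T : Set E4 := {y | 5/4 * r ≤ ‖y‖ ∧ ‖y‖ ≤ 9/10}
  have hT : IsClosed T := (isClosed_le continuous_const continuous_norm).inter
          (isClosed_le continuous_norm continuous_const)
  have hTc : IsCompact T := by
    refine (isCompact_closedBall (0:E4) (9/10)).of_isClosed_subset hT ?_
    intro x hx; simpa using hx.2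
  have hTA : T ⊆ Ann r := fun y hy => ⟨by linarith [hy.1], by linarith [hy.2]⟩
  have hz : ∀ y, y ∉ T → chi r y = 0 := by
    intro y hy
    by_cases h1 : ‖y‖ < 5/4 * r
    · rw [chi, cut_one _ (by norm_num) y (by linarith), cut_one r hr y h1.le, sub_self]
    · have h2 : 9/10 < ‖y‖ := by
        by_contra h3
        exact hy ⟨not_lt.1 h1, not_lt.1 h3⟩
      rw [chi, cut_zero _ (by norm_num) y (by linarith), cut_zero r hr y (by linarith), sub_self]
  have hts : tsupport (chi r) ⊆ T := by
    refine closure_minimal ?_ hT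
    intro y hy
    by_contra h
    exact hy (hz y h)
  have hchi : Continuous (chi r) := ((contDiff_cut (3/5)).sub (contDiff_cut r)).continuous
  have hg : Integrable (fun y => h y * chi r y) := int_mul _ (isOpen_Ann r) h _ hh hchi
    (hTc.of_isClosed_subset (isClosed_tsupport _) hts) (hts.trans hTA)
  have hgc : ContinuousAt (fun y => h y * chi r y) x :=
    (hh.continuousAt ((isOpen_Ann r).mem_nhds hx)).mul hchi.continuousAt
  have hchi1 : chi r x = 1 := by
    rw [chi, cut_one _ (by norm_num) x (by linarith), cut_zero r hr x (by linarith), sub_zero]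
  have hlim : Tendsto (fun z : E4 => ‖z‖ ^ Module.finrank ℝ E4 * (c0⁻¹ * phi0 z))
      (Bornology.cobounded E4) (nhds 0) := by
    rw [finrank_euclideanSpace_fin]
    have h1 : Tendsto (fun z : E4 => (8 * c0⁻¹) * (‖z‖ ^ 2)⁻¹) (Bornology.cobounded E4) (nhds 0) := by
      have := (tendsto_inv_atTop_zero.comp ((tendsto_pow_atTop (α := ℝ) two_ne_zero).comp
        (tendsto_norm_cobounded_atTop (E := E4)))).const_mul (8 * c0⁻¹)
      simpa using this
    have hev : ∀ᶠ z : E4 in Bornology.cobounded E4, 0 < ‖z‖ :=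
      (tendsto_norm_cobounded_atTop (E := E4)).eventually_gt_atTop 0
    refine squeeze_zero' (Eventually.of_forall fun z => ?_) ?_ h1
    · have := c0_pos; have := phi0_pos z; positivity
    · filter_upwards [hev] with z hz
      have := c0_pos
      have e : ‖z‖ ^ 4 * (c0⁻¹ * phi0 z) = 8 * c0⁻¹ * (‖z‖ ^ 4 * ((1 + ‖z‖ ^ 2)⁻¹) ^ 3) := by
        rw [phi0]; ring
      rw [e]
      refine mul_le_mul_of_nonneg_left ?_ (by positivity)
      rw [inv_pow, ← div_eq_mul_inv, div_le_iff₀ (by positivity), inv_mul_eq_div,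
        le_div_iff₀ (by positivity)]
      have := sq_nonneg ‖z‖
      nlinarith [pow_nonneg this 2, pow_nonneg this 3]
  have key := tendsto_integral_comp_smul_smul_of_integrable' (μ := (volume : Measure E4))
    (φ := fun z => c0⁻¹ * phi0 z) (fun z => mul_nonneg (inv_nonneg.2 c0_pos.le) (phi0_pos z).le)
    (by rw [integral_const_mul]; exact inv_mul_cancel₀ c0_pos.ne') hlim hg hgc
  rw [finrank_euclideanSpace_fin] at key
  have key2 := key.const_mul c0
  simp only [hchi1, mul_one] at key2
  refine key2.congr' ?_
  filter_upwards [eventually_gt_atTop (0:ℝ)] with c hc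
  rw [← integral_const_mul]
  refine integral_congr_ae (Eventually.of_forall fun y => ?_)
  simp only [smul_eq_mul]
  rw [← scale_phi0 c hc x y]
  have := c0_pos.ne'
  field_simp

lemma shell_bound : ∃ K : ℝ, 0 < K ∧ ∀ (r s : ℝ) (h F : E4 → ℝ) (N P : ℝ), 0 < s → 0 ≤ N → 0 ≤ P →
    ContinuousOn h (Ann r) → Shell s ⊆ Ann r →
    eLpNorm h 2 (volume.restrict (Ann r)) = ENNReal.ofReal N →
    (∀ y ∈ Shell s, |F y| ≤ P / s ^ 2) → (∀ y, y ∉ Shell s → F y = 0) →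
    |∫ y, h y * F y| ≤ K * P * N := by
  let V : ℝ := (volume (Metric.ball (0:E4) 1)).toReal
  have hV : 0 < V := ENNReal.toReal_pos (Metric.measure_ball_pos volume _ one_pos).ne'
    measure_ball_lt_top.ne
  refine ⟨9/4 * V ^ (1/2:ℝ), by positivity, ?_⟩
  intro r s h F N P hs hN hP hh hS hE hF hF0
  have hmS : MeasurableSet (Shell s) := (isClosed_Shell s).measurableSet
  have hmeas : AEStronglyMeasurable h (volume.restrict (Shell s)) :=
    (hh.mono hS).aestronglyMeasurable hmS
  have hvol : volume (Shell s) ≤ ENNReal.ofReal ((3/2*s)^4 * V) := by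
    calc volume (Shell s) ≤ volume (Metric.closedBall (0:E4) (3/2*s)) :=
          measure_mono fun y hy => by simpa using hy.2
      _ = ENNReal.ofReal ((3/2*s)^4 * V) := by
          rw [Measure.addHaar_closedBall _ _ (by positivity), finrank_euclideanSpace_fin,
            ENNReal.ofReal_mul (by positivity), ENNReal.ofReal_toReal measure_ball_lt_top.ne]
  have h1 : eLpNorm h 1 (volume.restrict (Shell s)) ≤ ENNReal.ofReal (N * (9/4 * s^2 * V^(1/2:ℝ))) := by
    have := eLpNorm_le_eLpNorm_mul_rpow_measure_univ (p := 1) (q := 2) (by norm_num) hmeas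
    refine this.trans ?_
    rw [ENNReal.ofReal_mul hN, ← hE]
    refine mul_le_mul' (eLpNorm_mono_measure _ (Measure.restrict_mono hS le_rfl)) ?_
    rw [Measure.restrict_apply_univ]
    have e : (1 / (1:ℝ≥0∞).toReal - 1 / (2:ℝ≥0∞).toReal) = (1/2:ℝ) := by norm_num
    rw [e]
    calc volume (Shell s) ^ (1/2:ℝ) ≤ (ENNReal.ofReal ((3/2*s)^4 * V)) ^ (1/2:ℝ) :=
          ENNReal.rpow_le_rpow hvol (by norm_num)
      _ = ENNReal.ofReal (9/4 * s^2 * V^(1/2:ℝ)) := by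
          rw [ENNReal.ofReal_rpow_of_nonneg (by positivity) (by norm_num),
            Real.mul_rpow (by positivity) hV.le,
            show (3/2*s)^4 = (9/4*s^2)^2 by ring, ← Real.sqrt_eq_rpow (_ ^ 2), Real.sqrt_sq (by positivity)]
  have h2 : ‖∫ y, h y * F y‖ₑ ≤ ENNReal.ofReal (P / s^2) * ENNReal.ofReal (N * (9/4 * s^2 * V^(1/2:ℝ))) := by
    refine (enorm_integral_le_lintegral_enorm _).trans ?_
    refine le_trans ?_ (mul_le_mul_right h1 _)
    rw [eLpNorm_one_eq_lintegral_enorm, ← lintegral_const_mul' _ _ ENNReal.ofReal_ne_top,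
      ← lintegral_indicator hmS]
    refine lintegral_mono fun y => ?_
    by_cases hy : y ∈ Shell s
    · rw [indicator_of_mem hy, enorm_mul, mul_comm]
      gcongr
      rw [← ofReal_norm, Real.norm_eq_abs]
      exact ENNReal.ofReal_le_ofReal (hF y hy)
    · simp [hF0 y hy]
  rw [← ENNReal.ofReal_mul (by positivity), ← ofReal_norm,
    ENNReal.ofReal_le_ofReal_iff (by positivity), Real.norm_eq_abs] at h2
  refine h2.trans (le_of_eq ?_)
  field_simp

lemma Gam_nonneg (ε : ℝ) (hε : 0 < ε) (x y : E4) : 0 < Gam ε x y :=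
  inv_pos.2 (Gam_pos' ε hε x y)

lemma Gam_le (ε : ℝ) (hε : 0 < ε) (x y : E4) (d : ℝ) (hd : 0 < d) (hxy : d ≤ ‖x - y‖) :
    Gam ε x y ≤ (d ^ 2)⁻¹ := by
  unfold Gam
  gcongr
  nlinarith

lemma abs_coord_le (z : E4) (i : Fin 4) : |z i| ≤ ‖z‖ := by
  have := PiLp.norm_apply_le z i
  simpa using this

lemma Dd_Gam_le (ε : ℝ) (hε : 0 < ε) (x y : E4) (d : ℝ) (hd : 0 < d) (hxy : d ≤ ‖x - y‖) (i : Fin 4) :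
    |Dd i (Gam ε x) y| ≤ 2 / d ^ 3 := by
  rw [Dd_Gam ε hε x i]
  have h1 := abs_coord_le (x - y) i
  rw [PiLp.sub_apply] at h1
  have hn : 0 < ‖x - y‖ := hd.trans_le hxy
  have h2 := Gam_le ε hε x y ‖x - y‖ hn le_rfl
  have h0 := Gam_nonneg ε hε x y
  beta_reduce
  rw [abs_mul, abs_mul, abs_two, abs_of_nonneg (pow_nonneg h0.le 2)]
  calc 2 * |x i - y i| * Gam ε x y ^ 2 ≤ 2 * ‖x - y‖ * ((‖x - y‖ ^ 2)⁻¹) ^ 2 := by gcongr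
    _ = 2 / ‖x - y‖ ^ 3 := by field_simp
    _ ≤ 2 / d ^ 3 := by gcongr

lemma Gam_diff (ε : ℝ) (hε : 0 < ε) (x y : E4) (r : ℝ) (hr : 0 < r) (hx : 2 * r ≤ ‖x‖)
    (hy : ‖y‖ ≤ 3/2 * r) : |Gam ε x y - Gam ε x 0| ≤ 30 * r / ‖x‖ ^ 3 := by
  have ha : 0 < ‖x‖ := by linarith
  have hb : ‖x‖ / 4 ≤ ‖x - y‖ := by
    have := norm_sub_norm_le x y
    linarith
  have hb0 : 0 < ‖x - y‖ := by linarith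
  have h1 := Gam_le ε hε x y _ hb0 le_rfl
  have h2 := Gam_le ε hε x 0 ‖x‖ ha (by simp)
  have p1 := Gam_nonneg ε hε x y
  have p2 := Gam_nonneg ε hε x 0
  have e : Gam ε x y - Gam ε x 0 = (‖x‖ ^ 2 - ‖x - y‖ ^ 2) * (Gam ε x y * Gam ε x 0) := by
    have q1 := (Gam_pos' ε hε x y).ne'
    have q2 := (Gam_pos' ε hε x 0).ne'
    simp only [Gam] at *
    rw [sub_zero] at *
    field_simp
    ring
  have h3 : |‖x‖ ^ 2 - ‖x - y‖ ^ 2| ≤ 3/2 * r * (‖x‖ + ‖x - y‖) := by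
    have e2 : ‖x‖ ^ 2 - ‖x - y‖ ^ 2 = (‖x‖ - ‖x - y‖) * (‖x‖ + ‖x - y‖) := by ring
    rw [e2, abs_mul, abs_of_pos (by positivity : 0 < ‖x‖ + ‖x - y‖)]
    gcongr
    have := abs_norm_sub_norm_le x (x - y)
    rw [_root_.sub_sub_cancel] at this
    linarith
  rw [e, abs_mul, abs_of_pos (mul_pos p1 p2)]
  calc |‖x‖ ^ 2 - ‖x - y‖ ^ 2| * (Gam ε x y * Gam ε x 0)
      ≤ 3/2 * r * (‖x‖ + ‖x - y‖) * ((‖x - y‖ ^ 2)⁻¹ * (‖x‖ ^ 2)⁻¹) := by gcongr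
    _ = 3/2 * r * (1 / (‖x - y‖ ^ 2 * ‖x‖) + 1 / (‖x - y‖ * ‖x‖ ^ 2)) := by field_simp
    _ ≤ 3/2 * r * (1 / ((‖x‖/4) ^ 2 * ‖x‖) + 1 / ((‖x‖/4) * ‖x‖ ^ 2)) := by gcongr
    _ = 30 * r / ‖x‖ ^ 3 := by field_simp; norm_num

lemma Comm_bound (η : E4 → ℝ) (ε q : ℝ) (x y : E4) (M s g0 g1 : ℝ) (hM : 0 ≤ M) (hs : 0 < s)
    (h1 : ∀ i, |Dd i η y| ≤ M / s) (h2 : ∀ i, |Dd i (Dd i η) y| ≤ M / s ^ 2)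
    (h3 : ∀ i, |Dd i (Gam ε x) y| ≤ g1) (h4 : |Gam ε x y - q| ≤ g0) :
    |Comm η ε q x y| ≤ (8 * M * s * g1 + 4 * M * g0) / s ^ 2 := by
  have hb : ∀ i : Fin 4, |2 * (Dd i η y * Dd i (Gam ε x) y) + Dd i (Dd i η) y * (Gam ε x y - q)| ≤
      2 * (M / s * g1) + M / s ^ 2 * g0 := by
    intro i
    refine (abs_add_le _ _).trans ?_
    rw [abs_mul, abs_mul, abs_mul, abs_two]
    have a1 := h1 i; have a2 := h2 i; have a3 := h3 i
    gcongr
  calc |Comm η ε q x y| ≤ ∑ i : Fin 4, |2 * (Dd i η y * Dd i (Gam ε x) y) + Dd i (Dd i η) y * (Gam ε x y - q)| :=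
        Finset.abs_sum_le_sum_abs _ _
    _ ≤ ∑ i : Fin 4, (2 * (M / s * g1) + M / s ^ 2 * g0) := Finset.sum_le_sum fun i _ => hb i
    _ = (8 * M * s * g1 + 4 * M * g0) / s ^ 2 := by
        simp only [Finset.sum_const, Finset.card_univ, Fintype.card_fin, nsmul_eq_mul]
        field_simp
        push_cast
        ring

lemma pointwise : ∃ C : ℝ, 0 < C ∧ ∀ (r : ℝ), 0 < r → r < 1/8 → ∀ (h : E4 → ℝ) (N : ℝ), 0 ≤ N →
    IsHarmonicOn h (Ann r) → eLpNorm h 2 (volume.restrict (Ann r)) = ENNReal.ofReal N →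
    ∃ β : ℝ, ∀ x : E4, 2 * r ≤ ‖x‖ → ‖x‖ ≤ 5/8 →
      |c0 * h x - β * (‖x‖ ^ 2)⁻¹| ≤ C * N * (1 + r / ‖x‖ ^ 3) := by
  obtain ⟨M, hM, hcut⟩ := exists_M
  obtain ⟨K, hK, hsh⟩ := shell_bound
  refine ⟨K * (6000 * M), by positivity, ?_⟩
  intro r hr hr8 h N hN hh hE
  refine ⟨-∫ y, h y * ∑ i, Dd i (Dd i (cut r)) y, fun x hx1 hx2 => ?_⟩
  set β := -∫ y, h y * ∑ i, Dd i (Dd i (cut r)) y with hβ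
  have hcon := hh.1.continuousOn
  have S1 : Shell (3/5) ⊆ Ann r := fun y hy => ⟨by linarith [hy.1], by linarith [hy.2]⟩
  have S2 : Shell r ⊆ Ann r := fun y hy => ⟨by linarith [hy.1], by linarith [hy.2]⟩
  have ha : 0 < ‖x‖ := by linarith
  have main : ∀ ε : ℝ, 0 < ε → |(∫ y, h y * (8 * ε * (Gam ε x y) ^ 3 * chi r y)) - Gam ε x 0 * β| ≤
      K * (6000 * M) * N * (1 + r / ‖x‖ ^ 3) := by
    intro ε hε
    rw [kernel_identity r hr hr8 h hh ε hε x]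
    have B1 : |∫ y, h y * Comm (cut (3/5)) ε 0 x y| ≤ K * (6000 * M) * N := by
      refine hsh r (3/5) h _ N (6000 * M) (by norm_num) hN (by positivity) hcon S1 hE ?_
        (fun y hy => Comm_cut_zero _ (by norm_num) ε 0 x y hy)
      intro y hy
      have hd : 1/8 ≤ ‖x - y‖ := by
        have := norm_sub_norm_le y x
        rw [norm_sub_rev] at this
        linarith [hy.1]
      have := Comm_bound (cut (3/5)) ε 0 x y M (3/5) (((1/8:ℝ)^2)⁻¹) _ hM.le (by norm_num)
        (fun i => (hcut (3/5) (by norm_num) i y).1) (fun i => (hcut (3/5) (by norm_num) i y).2)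
        (fun i => Dd_Gam_le ε hε x y (1/8) (by norm_num) hd i)
        (by rw [sub_zero, abs_of_pos (Gam_nonneg ε hε x y)]
            exact Gam_le ε hε x y (1/8) (by norm_num) hd)
      refine this.trans ?_
      gcongr
      norm_num
      linarith
    have i2 := int_shell r r h _ hcon S2 (continuous_Comm ε (Gam ε x 0) hε x _ (contDiff_cut r))
      (fun y hy => Comm_cut_zero _ hr ε (Gam ε x 0) x y hy)
    have i3 := int_shell r r h _ hcon S2 (continuous_lap_cut r) (lap_cut_zero r hr)
    have e : ∫ y, h y * Comm (cut r) ε 0 x y =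
        (∫ y, h y * Comm (cut r) ε (Gam ε x 0) x y) - Gam ε x 0 * β := by
      have : ∀ y, h y * Comm (cut r) ε 0 x y = h y * Comm (cut r) ε (Gam ε x 0) x y +
          Gam ε x 0 * (h y * ∑ i, Dd i (Dd i (cut r)) y) := by
        intro y
        rw [Comm_q ε (Gam ε x 0)]; ring
      simp only [this]
      rw [integral_add i2 (i3.const_mul _), integral_const_mul, hβ]
      ring
    have B2 : |∫ y, h y * Comm (cut r) ε (Gam ε x 0) x y| ≤ K * (6000 * M * (r / ‖x‖ ^ 3)) * N := by
      refine hsh r r h _ N _ hr hN (by positivity) hcon S2 hE ?_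
        (fun y hy => Comm_cut_zero _ hr ε (Gam ε x 0) x y hy)
      intro y hy
      have hd : ‖x‖/4 ≤ ‖x - y‖ := by
        have := norm_sub_norm_le x y
        linarith [hy.2]
      have := Comm_bound (cut r) ε (Gam ε x 0) x y M r _ _ hM.le hr
        (fun i => (hcut r hr i y).1) (fun i => (hcut r hr i y).2)
        (fun i => Dd_Gam_le ε hε x y (‖x‖/4) (by positivity) hd i)
        (Gam_diff ε hε x y r hr hx1 hy.2)
      refine this.trans ?_
      gcongr
      have e : 8 * M * r * (2 / (‖x‖/4)^3) + 4 * M * (30 * r / ‖x‖^3) = 1144 * (M * (r / ‖x‖^3)) := by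
        field_simp; norm_num
      rw [e]
      have : 0 < M * (r / ‖x‖^3) := by positivity
      linarith
    rw [e]
    have e4 : ∀ a b c : ℝ, a - (b - c) - c = a - b := by intros; ring
    rw [e4]
    refine (abs_sub _ _).trans ?_
    refine (add_le_add B1 B2).trans (le_of_eq ?_)
    ring
  have hlim := tendsto_kernel r hr hr8 h hcon x hx1 hx2
  have hG : Tendsto (fun c : ℝ => Gam ((c ^ 2)⁻¹) x 0 * β) atTop (nhds ((‖x‖ ^ 2)⁻¹ * β)) := by
    refine Tendsto.mul_const _ ?_
    simp only [Gam, sub_zero]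
    have h0 : Tendsto (fun c : ℝ => ‖x‖ ^ 2 + (c ^ 2)⁻¹) atTop (nhds (‖x‖ ^ 2 + 0)) :=
      (tendsto_inv_atTop_zero.comp (tendsto_pow_atTop two_ne_zero)).const_add _
    rw [add_zero] at h0
    exact h0.inv₀ (by positivity)
  have := (hlim.sub hG).abs
  rw [mul_comm β]
  refine le_of_tendsto this ?_
  filter_upwards [eventually_gt_atTop (0:ℝ)] with c hc
  exact main _ (by positivity)

lemma cont_h_act (r : ℝ) (h : E4 → ℝ) (hc : ContinuousOn h {x | r ≤ ‖x‖ ∧ ‖x‖ ≤ 1}) (x : E4)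
    (hx1 : r ≤ ‖x‖) (hx2 : ‖x‖ ≤ 1) : Continuous (fun p : GQ => h (act p x)) := by
  rw [← continuousOn_univ]
  refine hc.comp (cont_act continuous_id continuous_const).continuousOn (fun p _ => ?_)
  show r ≤ ‖act p x‖ ∧ ‖act p x‖ ≤ 1
  rw [norm_act]
  exact ⟨hx1, hx2⟩

lemma avg_affine (r : ℝ) (h : E4 → ℝ) (hc : ContinuousOn h {x | r ≤ ‖x‖ ∧ ‖x‖ ≤ 1}) (x : E4)
    (hx1 : r ≤ ‖x‖) (hx2 : ‖x‖ ≤ 1) (c d : ℝ) :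
    ∫ p, (c * h (act p x) + d) ∂muG = c * avg h x + d := by
  have i := intGQ (cont_h_act r h hc x hx1 hx2)
  rw [integral_add (i.const_mul c) (integrable_const _), integral_const_mul, avg_def]
  simp

lemma gbound : ∃ C : ℝ, 0 < C ∧ ∀ (r : ℝ), 0 < r → r < 1/8 → ∀ (h : E4 → ℝ) (N : ℝ), 0 ≤ N →
    ContinuousOn h {x | r ≤ ‖x‖ ∧ ‖x‖ ≤ 1} →
    IsHarmonicOn h (Ann r) → eLpNorm h 2 (volume.restrict (Ann r)) = ENNReal.ofReal N →
    ∀ A B : ℝ, (∀ x : E4, r ≤ ‖x‖ → ‖x‖ ≤ 1 → avg h x = A + B * (‖x‖ ^ 2)⁻¹) →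
    ∀ x : E4, 2 * r ≤ ‖x‖ → ‖x‖ ≤ 1/2 →
      |h x - A - B * (‖x‖ ^ 2)⁻¹| ≤ C * N * (1 + r / ‖x‖ ^ 3) := by
  obtain ⟨C, hC, hp⟩ := pointwise
  have c0p := c0_pos
  refine ⟨23 * C / c0, by positivity, ?_⟩
  intro r hr hr8 h N hN hc hh hE A B hAB x hx1 hx2
  obtain ⟨β, hβ⟩ := hp r hr hr8 h N hN hh hE
  have havg : ∀ ρ : ℝ, 2 * r ≤ ρ → ρ ≤ 5/8 →
      |c0 * A + (c0 * B - β) * (ρ ^ 2)⁻¹| ≤ C * N * (1 + r / ρ ^ 3) := by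
    intro ρ h1 h2
    have hρ : 0 < ρ := by linarith
    have hn : ‖ρ • ee 0‖ = ρ := by simp [norm_smul, abs_of_pos hρ]
    have e := avg_affine r h hc (ρ • ee 0) (by rw [hn]; linarith) (by rw [hn]; linarith) c0
      (-(β * (ρ ^ 2)⁻¹))
    rw [hAB _ (by rw [hn]; linarith) (by rw [hn]; linarith), hn] at e
    have b := norm_integral_le_of_norm_le_const (μ := muG)
      (f := fun p => c0 * h (act p (ρ • ee 0)) + -(β * (ρ ^ 2)⁻¹)) (C := C * N * (1 + r / ρ ^ 3))
      (Eventually.of_forall fun p => by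
        have := hβ (act p (ρ • ee 0)) (by rw [norm_act, hn]; exact h1) (by rw [norm_act, hn]; exact h2)
        rw [norm_act, hn] at this
        rw [Real.norm_eq_abs, ← sub_eq_add_neg]
        exact this)
    rw [e, Real.norm_eq_abs] at b
    simp only [probReal_univ, mul_one] at b
    refine le_of_eq_of_le ?_ b
    congr 1
    ring
  obtain ⟨t, ht0, htr⟩ : ∃ t : ℝ, 0 < t ∧ t ^ 3 = r := by
    refine ⟨r ^ ((3:ℕ):ℝ)⁻¹, by positivity, ?_⟩
    exact Real.rpow_inv_natCast_pow hr.le (by norm_num)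
  have ht2 : t < 1/2 := by
    by_contra hcon
    have : (1/2:ℝ) ^ 3 ≤ t ^ 3 := by gcongr; linarith
    norm_num at this
    linarith
  have hCN : 0 ≤ C * N := by positivity
  have e1 := havg (5/8) (by linarith) le_rfl
  have e2 := havg t (by rw [← htr]; nlinarith [mul_pos ht0 ht0]) (by linarith)
  rw [← htr] at e1 e2
  have f1 : |c0 * A + (c0 * B - β) * (64/25)| ≤ 2 * (C * N) := by
    have : ((5/8:ℝ)^2)⁻¹ = 64/25 := by norm_num
    rw [this] at e1
    refine e1.trans ?_
    have : t ^ 3 / (5/8:ℝ)^3 ≤ 1 := by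
      rw [htr]; norm_num; linarith
    nlinarith
  have f2 : |c0 * A + (c0 * B - β) * (t^2)⁻¹| ≤ 2 * (C * N) := by
    rw [div_self (by positivity)] at e2
    linarith
  set A' := c0 * A
  set B' := c0 * B - β with hB'
  have hu : t ^ 2 * (t^2)⁻¹ = 1 := by field_simp
  have hBb : |B'| ≤ 12 * (C * N) * t ^ 2 := by
    have g : |B' * ((t^2)⁻¹ - 64/25)| ≤ 4 * (C * N) := by
      have : B' * ((t^2)⁻¹ - 64/25) = (A' + B' * (t^2)⁻¹) - (A' + B' * (64/25)) := by ring
      rw [this]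
      refine (abs_sub _ _).trans ?_
      linarith
    have u4 : 4 ≤ (t^2)⁻¹ := by
      rw [le_inv_comm₀ (by norm_num) (by positivity)]
      nlinarith
    rw [abs_mul, abs_of_pos (by linarith : 0 < (t^2)⁻¹ - 64/25)] at g
    have g2 : |B'| * (9/25 * (t^2)⁻¹) ≤ 4 * (C * N) := by
      refine le_trans ?_ g
      exact mul_le_mul_of_nonneg_left (by linarith) (abs_nonneg _)
    have g3 : |B'| * (9/25) = (|B'| * (9/25 * (t^2)⁻¹)) * t^2 := by field_simp
    have g4 : |B'| * (9/25) ≤ 4 * (C * N) * t^2 := by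
      rw [g3]; gcongr
    nlinarith [mul_nonneg hCN (sq_nonneg t)]
  have hAb : |A'| ≤ 10 * (C * N) := by
    have : A' = (A' + B' * (64/25)) - B' * (64/25) := by ring
    have t4 : t^2 ≤ 1/4 := by nlinarith
    have hb2 : |B'| ≤ 3 * (C * N) := by nlinarith
    rw [this]
    refine (abs_sub _ _).trans ?_
    rw [abs_mul, abs_of_pos (by norm_num : (0:ℝ) < 64/25)]
    linarith
  have ha : 0 < ‖x‖ := by linarith
  have e3 := hβ x hx1 (by linarith)
  have hu3 : t^2 * (‖x‖^2)⁻¹ ≤ 1 + r / ‖x‖^3 := by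
    rw [← htr, ← div_eq_mul_inv, ← div_pow, ← div_pow]
    have : 0 < t / ‖x‖ := by positivity
    set u := t / ‖x‖
    rcases le_total u 1 with hu1 | hu1
    · nlinarith [pow_pos this 3]
    · nlinarith [mul_nonneg (sq_nonneg u) (sub_nonneg.2 hu1)]
  have hfin : |c0 * (h x - A - B * (‖x‖^2)⁻¹)| ≤ 23 * (C * N) * (1 + r / ‖x‖^3) := by
    have : c0 * (h x - A - B * (‖x‖^2)⁻¹) =
        (c0 * h x - β * (‖x‖^2)⁻¹) - A' - B' * (‖x‖^2)⁻¹ := by simp only [A', hB']; ring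
    rw [this]
    refine (abs_sub _ _).trans ?_
    have h1 := abs_sub (c0 * h x - β * (‖x‖^2)⁻¹) A'
    have h2 : |B' * (‖x‖^2)⁻¹| ≤ 12 * (C * N) * (1 + r / ‖x‖^3) := by
      rw [abs_mul, abs_of_pos (by positivity : 0 < (‖x‖^2)⁻¹)]
      calc |B'| * (‖x‖^2)⁻¹ ≤ 12 * (C * N) * t^2 * (‖x‖^2)⁻¹ := by gcongr
        _ = 12 * (C * N) * (t^2 * (‖x‖^2)⁻¹) := by ring
        _ ≤ _ := by gcongr
    have h3 : 0 ≤ r / ‖x‖^3 := by positivity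
    nlinarith [mul_nonneg hCN h3]
  rw [abs_mul, abs_of_pos c0p] at hfin
  rw [← mul_le_mul_iff_right₀ c0p]
  refine hfin.trans (le_of_eq ?_)
  field_simp

lemma Lam_bound : ∃ C : ℝ, 0 < C ∧ ∀ (r : ℝ), 0 < r → r < 1/8 → ∀ (g : E4 → ℝ) (K : ℝ), 0 ≤ K →
    (∀ x : E4, 2 * r ≤ ‖x‖ → ‖x‖ ≤ 1/2 → |g x| ≤ K * (1 + r / ‖x‖ ^ 3)) →
    Lam {x | 2 * r < ‖x‖ ∧ ‖x‖ < 1 / 2} g ≤ ENNReal.ofReal (C * K) := by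
  let V : ℝ := (volume (Metric.ball (0:E4) 1)).toReal
  have hV : 0 < V := ENNReal.toReal_pos (Metric.measure_ball_pos volume _ one_pos).ne'
    measure_ball_lt_top.ne
  have hball : ∀ R : ℝ, 0 ≤ R → (volume (Metric.ball (0:E4) R)) ^ (1/2:ℝ) = ENNReal.ofReal (R^2 * V^(1/2:ℝ)) := by
    intro R hR
    rw [Measure.addHaar_ball _ _ hR, finrank_euclideanSpace_fin,
      ← ENNReal.ofReal_toReal (measure_ball_lt_top (μ := volume) (x := (0:E4)) (r := 1)).ne,
      ← ENNReal.ofReal_mul (by positivity), ENNReal.ofReal_rpow_of_nonneg (by positivity) (by norm_num),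
      Real.mul_rpow (by positivity) hV.le, show R^4 = (R^2)^2 by ring, ← Real.sqrt_eq_rpow (_ ^ 2),
      Real.sqrt_sq (by positivity)]
  refine ⟨8 * V^(1/2:ℝ), by positivity, ?_⟩
  intro r hr hr8 g K hK hg
  set W := V^(1/2:ℝ) with hW
  have hW0 : 0 < W := by positivity
  set L : ℝ := K * (r^2)⁻¹ with hL
  have hL0 : 0 ≤ L := by positivity
  let f1 : ℝ → ℝ≥0∞ := (Ioc 0 (2*K)).indicator fun _ => ENNReal.ofReal W
  let f2 : ℝ → ℝ≥0∞ := (Ioc 0 L).indicator fun l =>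
    ENNReal.ofReal (W * ((2*K*r)^(2/3:ℝ) * l^(-(2/3):ℝ)))
  have hle : ∀ l ∈ Ioi (0:ℝ), (volume {x : E4 | x ∈ {x : E4 | 2 * r < ‖x‖ ∧ ‖x‖ < 1 / 2} ∧ l < |g x|}) ^ ((1:ℝ)/2)
      ≤ f1 l + f2 l := by
    intro l hl
    have hl : 0 < l := hl
    by_cases h1 : l ≤ 2 * K
    · refine le_trans ?_ le_self_add
      simp only [f1]
      rw [indicator_of_mem (show l ∈ Ioc 0 (2*K) from ⟨hl, h1⟩)]
      have := hball 1 (by norm_num)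
      rw [one_pow, one_mul] at this
      rw [← this]
      refine ENNReal.rpow_le_rpow (measure_mono ?_) (by norm_num)
      rintro x ⟨⟨_, hx⟩, _⟩
      rw [mem_ball_zero_iff]; linarith
    · push Not at h1
      by_cases h2 : l ≤ L
      · refine le_trans ?_ le_add_self
        simp only [f2]
        rw [indicator_of_mem (show l ∈ Ioc 0 L from ⟨hl, h2⟩)]
        set w := 2*K*r/l with hw
        have hw0 : 0 ≤ w := by positivity
        have hsub : {x : E4 | x ∈ {x : E4 | 2 * r < ‖x‖ ∧ ‖x‖ < 1 / 2} ∧ l < |g x|} ⊆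
            Metric.ball (0:E4) (w ^ ((3:ℕ):ℝ)⁻¹) := by
          rintro x ⟨⟨hx1, hx2⟩, hx3⟩
          rw [mem_ball_zero_iff]
          have ha : 0 < ‖x‖ := by linarith
          have hb := hg x hx1.le hx2.le
          have h3 : ‖x‖ ^ 3 < w := by
            rw [hw, lt_div_iff₀ hl]
            have h4 : l / 2 < K * r / ‖x‖^3 := by
              have : K * (1 + r / ‖x‖^3) = K + K * r / ‖x‖^3 := by ring
              linarith
            rw [lt_div_iff₀ (by positivity)] at h4
            linarith
          rw [← Real.pow_rpow_inv_natCast ha.le (by norm_num : 3 ≠ 0)]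
          exact Real.rpow_lt_rpow (by positivity) h3 (by positivity)
        refine (ENNReal.rpow_le_rpow (measure_mono hsub) (by norm_num)).trans ?_
        rw [hball _ (by positivity)]
        refine ENNReal.ofReal_le_ofReal (le_of_eq ?_)
        rw [mul_comm]
        congr 1
        rw [← Real.rpow_natCast, ← Real.rpow_mul hw0, hw, Real.div_rpow (by positivity) hl.le,
          Real.rpow_neg hl.le, div_eq_mul_inv]
        norm_num
      · push Not at h2
        have : {x : E4 | x ∈ {x : E4 | 2 * r < ‖x‖ ∧ ‖x‖ < 1 / 2} ∧ l < |g x|} = ∅ := by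
          rw [eq_empty_iff_forall_notMem]
          rintro x ⟨⟨hx1, hx2⟩, hx3⟩
          have hb := hg x hx1.le hx2.le
          have h5 : r / ‖x‖^3 ≤ (r^2)⁻¹ / 8 := by
            calc r / ‖x‖^3 ≤ r / (2*r)^3 := by gcongr
              _ = _ := by field_simp; norm_num
          have h6 : 64 ≤ (r^2)⁻¹ := by
            rw [le_inv_comm₀ (by norm_num) (by positivity)]
            nlinarith
          have h7 : K * (1 + r / ‖x‖^3) ≤ K * (r^2)⁻¹ := by
            gcongr; linarith
          linarith
        rw [this]
        simp
  have hI1 : ∫⁻ l in Ioi (0:ℝ), f1 l ≤ ENNReal.ofReal (2 * W * K) := by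
    refine (setLIntegral_le_lintegral _ _).trans ?_
    simp only [f1]
    rw [lintegral_indicator measurableSet_Ioc, lintegral_const, Measure.restrict_apply_univ,
      Real.volume_Ioc, ← ENNReal.ofReal_mul hW0.le]
    refine ENNReal.ofReal_le_ofReal (le_of_eq ?_)
    ring
  have hI2 : ∫⁻ l in Ioi (0:ℝ), f2 l ≤ ENNReal.ofReal (6 * W * K) := by
    refine (setLIntegral_le_lintegral _ _).trans ?_
    simp only [f2]
    rw [lintegral_indicator measurableSet_Ioc]
    have hint : IntervalIntegrable (fun l : ℝ => W * ((2*K*r)^(2/3:ℝ) * l^(-(2/3):ℝ))) volume 0 L :=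
      ((intervalIntegral.intervalIntegrable_rpow' (by norm_num)).const_mul _).const_mul _
    rw [intervalIntegrable_iff_integrableOn_Ioc_of_le hL0] at hint
    rw [← ofReal_integral_eq_lintegral_ofReal hint ?_, ← intervalIntegral.integral_of_le hL0,
      intervalIntegral.integral_const_mul, intervalIntegral.integral_const_mul,
      integral_rpow (Or.inl (by norm_num))]
    · refine ENNReal.ofReal_le_ofReal ?_
      have e1 : (-(2/3):ℝ) + 1 = 1/3 := by norm_num
      rw [e1, Real.zero_rpow (by norm_num), sub_zero]
      have e2 : (2*K*r)^(2/3:ℝ) = ((2*K*r)^2)^(1/3:ℝ) := by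
        rw [← Real.rpow_natCast, ← Real.rpow_mul (by positivity)]; norm_num
      have e3 : (2*K*r)^(2/3:ℝ) * L^(1/3:ℝ) ≤ 2 * K := by
        rw [e2, ← Real.mul_rpow (by positivity) hL0]
        have e4 : (2*K*r)^2 * L = 4 * K^3 := by rw [hL]; field_simp; norm_num; ring
        have e5 : ((2*K)^3)^(1/3:ℝ) = 2 * K := by
          have := Real.pow_rpow_inv_natCast (by positivity : 0 ≤ 2*K) (by norm_num : 3 ≠ 0)
          simpa using this
        rw [e4, ← e5]
        refine Real.rpow_le_rpow (by positivity) ?_ (by norm_num)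
        nlinarith [pow_nonneg hK 3]
      have e6 : W * ((2*K*r)^(2/3:ℝ) * (L^(1/3:ℝ) / (1/3))) = 3 * W * ((2*K*r)^(2/3:ℝ) * L^(1/3:ℝ)) := by ring
      rw [e6]
      nlinarith
    · refine (ae_restrict_iff' measurableSet_Ioc).2 (Eventually.of_forall fun l hl => ?_)
      have : 0 ≤ l := hl.1.le
      simp only [Pi.zero_apply]
      positivity
  have hm1 : Measurable f1 := measurable_const.indicator measurableSet_Ioc
  calc Lam {x | 2 * r < ‖x‖ ∧ ‖x‖ < 1 / 2} g ≤ ∫⁻ l in Ioi (0:ℝ), (f1 l + f2 l) :=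
        setLIntegral_mono' measurableSet_Ioi hle
    _ = (∫⁻ l in Ioi (0:ℝ), f1 l) + ∫⁻ l in Ioi (0:ℝ), f2 l := lintegral_add_left hm1 _
    _ ≤ ENNReal.ofReal (2 * W * K) + ENNReal.ofReal (6 * W * K) := add_le_add hI1 hI2
    _ = ENNReal.ofReal (8 * W * K) := by
        rw [← ENNReal.ofReal_add (by positivity) (by positivity)]
        congr 1; ring

theorem harmonic_annulus_normalized_L21_estimate :
    ∃ C : ℝ, 0 < C ∧
      ∀ (r : ℝ), r ∈ Set.Ioo (0 : ℝ) (1 / 8) →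
      ∀ h : EuclideanSpace ℝ (Fin 4) → ℝ,
        ContinuousOn h {x | r ≤ ‖x‖ ∧ ‖x‖ ≤ 1} →
        IsHarmonicOn h {x | r < ‖x‖ ∧ ‖x‖ < 1} →
        ∃ a b : ℝ,
          (∫ x in Metric.sphere (0 : EuclideanSpace ℝ (Fin 4)) 1,
              (h x + a + b * (‖x‖ ^ 2)⁻¹) ∂(μH[(3 : ℝ)])) = 0 ∧
          (∫ x in Metric.sphere (0 : EuclideanSpace ℝ (Fin 4)) r,
              (h x + a + b * (‖x‖ ^ 2)⁻¹) ∂(μH[(3 : ℝ)])) = 0 ∧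
          Lam {x | 2 * r < ‖x‖ ∧ ‖x‖ < 1 / 2}
              (fun x => h x + a + b * (‖x‖ ^ 2)⁻¹) ≤
            ENNReal.ofReal C *
              eLpNorm h 2 (volume.restrict {x | r < ‖x‖ ∧ ‖x‖ < 1}) := by
  obtain ⟨C1, hC1, hg⟩ := gbound
  obtain ⟨C2, hC2, hL⟩ := Lam_bound
  refine ⟨C2 * C1, by positivity, ?_⟩
  rintro r ⟨hr, hr8⟩ h hc hh
  have hh' : IsHarmonicOn h (Ann r) := hh
  obtain ⟨A, B, hAB⟩ := avg_form r hr (by linarith) h hc hh'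
  have hsph : ∀ ρ : ℝ, r ≤ ρ → ρ ≤ 1 → ∫ x in Metric.sphere (0 : E4) ρ,
      (h x + (-A) + (-B) * (‖x‖ ^ 2)⁻¹) ∂(μH[(3 : ℝ)]) = 0 := by
    intro ρ h1 h2
    have hρ : 0 < ρ := by linarith
    refine integral_sphere_zero (fun x => h x + (-A) + (-B) * (‖x‖ ^ 2)⁻¹) ρ hρ ?_ ?_
    · have hsub : Metric.sphere (0:E4) ρ ⊆ {x | r ≤ ‖x‖ ∧ ‖x‖ ≤ 1} := by
        intro x hx
        rw [mem_sphere_zero_iff_norm] at hx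
        exact ⟨by rw [hx]; exact h1, by rw [hx]; exact h2⟩
      refine ((hc.mono hsub).add continuousOn_const).add (continuousOn_const.mul
        (ContinuousOn.inv₀ (by fun_prop) ?_))
      intro x hx
      rw [mem_sphere_zero_iff_norm] at hx
      rw [hx]; positivity
    · intro x hx
      rw [mem_sphere_zero_iff_norm] at hx
      have e := avg_affine r h hc x (by rw [hx]; exact h1) (by rw [hx]; exact h2) 1
        (-A + (-B) * (‖x‖ ^ 2)⁻¹)
      rw [hAB x (by rw [hx]; exact h1) (by rw [hx]; exact h2)] at e
      rw [avg_def]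
      simp only [norm_act, add_assoc]
      simp only [one_mul] at e
      rw [e]
      ring
  refine ⟨-A, -B, hsph 1 (by linarith) le_rfl, hsph r le_rfl (by linarith), ?_⟩
  have hcomp : IsCompact {x : E4 | r ≤ ‖x‖ ∧ ‖x‖ ≤ 1} := by
    refine (isCompact_closedBall (0:E4) 1).of_isClosed_subset ?_ ?_
    · exact (isClosed_le continuous_const continuous_norm).inter
        (isClosed_le continuous_norm continuous_const)
    · intro x hx; simpa using hx.2
  obtain ⟨M, hM⟩ := hcomp.exists_bound_of_continuousOn hc
  have hmA : MeasurableSet (Ann r) := (isOpen_Ann r).measurableSet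
  have hfinA : volume (Ann r) < ⊤ := by
    refine lt_of_le_of_lt (measure_mono ?_) (measure_ball_lt_top (μ := volume) (x := (0:E4)) (r := 1))
    intro x hx
    rw [mem_ball_zero_iff]; exact hx.2
  haveI : IsFiniteMeasure (volume.restrict (Ann r)) := ⟨by
    rw [Measure.restrict_apply_univ]; exact hfinA⟩
  have hmem : MemLp h 2 (volume.restrict (Ann r)) := by
    refine MemLp.of_bound (hh'.1.continuousOn.aestronglyMeasurable hmA) M ?_
    refine (ae_restrict_iff' hmA).2 (Eventually.of_forall fun x hx => ?_)
    exact hM x ⟨hx.1.le, hx.2.le⟩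
  have hN : eLpNorm h 2 (volume.restrict (Ann r)) =
      ENNReal.ofReal (eLpNorm h 2 (volume.restrict (Ann r))).toReal :=
    (ENNReal.ofReal_toReal hmem.eLpNorm_ne_top).symm
  set N := (eLpNorm h 2 (volume.restrict (Ann r))).toReal with hNdef
  have hN0 : 0 ≤ N := ENNReal.toReal_nonneg
  have hb := hg r hr hr8 h N hN0 hc hh' hN A B hAB
  have := hL r hr hr8 (fun x => h x + (-A) + (-B) * (‖x‖ ^ 2)⁻¹) (C1 * N) (by positivity)
    (fun x hx1 hx2 => by
      have := hb x hx1 hx2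
      have e : h x + -A + -B * (‖x‖ ^ 2)⁻¹ = h x - A - B * (‖x‖ ^ 2)⁻¹ := by ring
      beta_reduce
      rw [e]; exact this)
  refine this.trans (le_of_eq ?_)
  change _ = ENNReal.ofReal (C2 * C1) * eLpNorm h 2 (volume.restrict (Ann r))
  rw [hN, ← ENNReal.ofReal_mul (by positivity), mul_assoc]
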